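/- arXiv:0710.3095 — 3 statements merged into one kernel-verified Lean document; each statement's English description precedes it below -/
import Mathlib

section
/- Let d ≥ 1 and let φ : ℕ → [0,∞) satisfy φ(0)=0, φ nondecreasing (condition (N)), the attractive condition (A): φ(l+m) ≤ φ(l)+φ(m), and the sublinearity condition (SL): lim_{n→∞} φ(n)/n = 0. Then the connectivity constant equals λ₀ = lim_{n→∞} (1/n) log Z_n = log(2d). More precisely, Z_n ≤ (2d)^n for all n, and for every R ≥ 1 and every n, (1/n) log Z_n ≥ log(2d) − c(d)/R² − |B_R ∩ ℤ^d|·φ(n)/n, where c(d) > 0 is a dimensional constant arising from the bound P_SRW(γ ⊂ B_R for n steps) ≥ exp(−c(d)n/R²) for simple random walk confined to the Euclidean ball B_R of radius R. -/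
open scoped BigOperators ENNReal
open Filter Topology

noncomputable section

namespace SIRW

abbrev Pt (d : ℕ) := Fin d → ℤ

variable {d : ℕ}

/-- A step of a nearest-neighbour walk: a vector of ℓ¹-norm one. -/
def IsStep (s : Pt d) : Prop := (∑ i, |s i|) = 1

/-- A nearest-neighbour path started at the origin, encoded by its list of steps. -/
def IsPath (γ : List (Pt d)) : Prop := ∀ s ∈ γ, IsStep s

/-- Position of the path after `k` steps (the path starts at the origin). -/
def pos (γ : List (Pt d)) (k : ℕ) : Pt d := (γ.take k).sum

/-- Displacement `D(γ) = γ(n) - γ(0)`. -/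
def disp (γ : List (Pt d)) : Pt d := γ.sum

/-- Local time of the path at the site `x`. -/
def locTime (γ : List (Pt d)) (x : Pt d) : ℕ :=
  ((Finset.range (γ.length + 1)).filter (fun k => pos γ k = x)).card

/-- The (finite) set of sites visited by the path. -/
def visited (γ : List (Pt d)) : Finset (Pt d) :=
  (Finset.range (γ.length + 1)).image (pos γ)

/-- Site potential `Φ(γ) = ∑_x φ(l_x(γ))`, for `φ : ℕ → [0,∞]` with `φ 0 = 0`. -/
def PotE (φ : ℕ → ℝ≥0∞) (γ : List (Pt d)) : ℝ≥0∞ :=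
  ∑ x ∈ visited γ, φ (locTime γ x)

/-- Site potential `Φ(γ) = ∑_x φ(l_x(γ))`, for real-valued `φ` with `φ 0 = 0`. -/
def PotR (φ : ℕ → ℝ) (γ : List (Pt d)) : ℝ :=
  ∑ x ∈ visited γ, φ (locTime γ x)

/-- `e^{-a}` for `a ∈ [0,∞]`, with `e^{-∞} = 0`. -/
def expNegE (a : ℝ≥0∞) : ℝ≥0∞ :=
  if a = ⊤ then 0 else ENNReal.ofReal (Real.exp (-a.toReal))

/-- `e^{a}` for `a ∈ [0,∞]`, with `e^{∞} = ∞`. -/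
def expE (a : ℝ≥0∞) : ℝ≥0∞ :=
  if a = ⊤ then ⊤ else ENNReal.ofReal (Real.exp a.toReal)

/-- Weight `W_λ(γ) = e^{-Φ(γ) - λ|γ|}` (extended-real-valued potential). -/
def wE (φ : ℕ → ℝ≥0∞) (lam : ℝ) (γ : List (Pt d)) : ℝ≥0∞ :=
  expNegE (PotE φ γ) * ENNReal.ofReal (Real.exp (-(lam * γ.length)))

/-- Weight `W_λ(γ) = e^{-Φ(γ) - λ|γ|}` (real-valued potential). -/
def wR (φ : ℕ → ℝ) (lam : ℝ) (γ : List (Pt d)) : ℝ≥0∞ :=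
  ENNReal.ofReal (Real.exp (-PotR φ γ - lam * γ.length))

/-- The set of `n`-step nearest-neighbour paths started at the origin. -/
def PathsN (d n : ℕ) : Set (List (Pt d)) := {γ | IsPath γ ∧ γ.length = n}

/-- Partition function `Z_n` (extended-real-valued potential). -/
def ZE (d : ℕ) (φ : ℕ → ℝ≥0∞) (n : ℕ) : ℝ≥0∞ :=
  ∑' γ : PathsN d n, expNegE (PotE φ (γ : List (Pt d)))

/-- Partition function `Z_n` (real-valued potential). -/
def ZR (d : ℕ) (φ : ℕ → ℝ) (n : ℕ) : ℝ≥0∞ :=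
  ∑' γ : PathsN d n, ENNReal.ofReal (Real.exp (-PotR φ (γ : List (Pt d))))

/-- Paths from `0` to `x`. -/
def Dpaths (x : Pt d) : Set (List (Pt d)) := {γ | IsPath γ ∧ disp γ = x}

/-- Paths from `0` to `x` hitting `x` only at their final point. -/
def Hpaths (x : Pt d) : Set (List (Pt d)) := {γ | IsPath γ ∧ disp γ = x ∧ locTime γ x = 1}

/-- Two-point function `D_λ(x)` (extended-real-valued potential). -/
def DEf (φ : ℕ → ℝ≥0∞) (lam : ℝ) (x : Pt d) : ℝ≥0∞ :=
  ∑' γ : Dpaths x, wE φ lam (γ : List (Pt d))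

/-- Two-point function `H_λ(x)` (extended-real-valued potential). -/
def HEf (φ : ℕ → ℝ≥0∞) (lam : ℝ) (x : Pt d) : ℝ≥0∞ :=
  ∑' γ : Hpaths x, wE φ lam (γ : List (Pt d))

/-- Two-point function `D_λ(x)` (real-valued potential). -/
def DRf (φ : ℕ → ℝ) (lam : ℝ) (x : Pt d) : ℝ≥0∞ :=
  ∑' γ : Dpaths x, wR φ lam (γ : List (Pt d))

/-- Two-point function `H_λ(x)` (real-valued potential). -/
def HRf (φ : ℕ → ℝ) (lam : ℝ) (x : Pt d) : ℝ≥0∞ :=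
  ∑' γ : Hpaths x, wR φ lam (γ : List (Pt d))

/-- Coercion of a lattice point to a real vector. -/
def ctR (x : Pt d) : Fin d → ℝ := fun i => (x i : ℝ)

/-- Componentwise floor `⌊M x⌋`. -/
def flr (M : ℝ) (x : Fin d → ℝ) : Pt d := fun i => ⌊M * x i⌋

/-- Euclidean scalar product on `ℝ^d`. -/
def inr (h x : Fin d → ℝ) : ℝ := ∑ i, h i * x i

/-- Euclidean norm on `ℝ^d`. -/
def nrm (x : Fin d → ℝ) : ℝ := Real.sqrt (∑ i, x i ^ 2)

/-- Wulff shape `K = {h : (h,x) ≤ ξ(x) ∀x}` associated with a norm `ξ`. -/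
def Kset (ξ : (Fin d → ℝ) → ℝ) : Set (Fin d → ℝ) := {h | ∀ x, inr h x ≤ ξ x}

/-- Weight `W_h(γ) = e^{-Φ(γ) + (h, D(γ))}` (extended-real-valued potential). -/
def wHE (φ : ℕ → ℝ≥0∞) (h : Fin d → ℝ) (γ : List (Pt d)) : ℝ≥0∞ :=
  expNegE (PotE φ γ) * ENNReal.ofReal (Real.exp (inr h (ctR (disp γ))))

/-- Partition function `Z_n^h` with drift `h` (extended-real-valued potential). -/
def ZHE (d : ℕ) (φ : ℕ → ℝ≥0∞) (h : Fin d → ℝ) (n : ℕ) : ℝ≥0∞ :=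
  ∑' γ : PathsN d n, wHE φ h (γ : List (Pt d))

/-- Weight `W_h(γ) = e^{-Φ(γ) + (h, D(γ))}` (real-valued potential). -/
def wHR (φ : ℕ → ℝ) (h : Fin d → ℝ) (γ : List (Pt d)) : ℝ≥0∞ :=
  ENNReal.ofReal (Real.exp (-PotR φ γ + inr h (ctR (disp γ))))

/-- Partition function `Z_n^h` with drift `h` (real-valued potential). -/
def ZHR (d : ℕ) (φ : ℕ → ℝ) (h : Fin d → ℝ) (n : ℕ) : ℝ≥0∞ :=
  ∑' γ : PathsN d n, wHR φ h (γ : List (Pt d))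

/-- Condition (SL) for an extended-real-valued potential: finiteness and sublinearity. -/
def SLE (φ : ℕ → ℝ≥0∞) : Prop :=
  (∀ n, φ n ≠ ⊤) ∧ Tendsto (fun n : ℕ => (φ n).toReal / n) atTop (𝓝 0)

/-- Forward cone `Y^>_δ(h) = {y : s_h(y) < δ ξ(y)}`, where `s_h(y) = ξ(y) - (h,y)`. -/
def Ygt (ξ : (Fin d → ℝ) → ℝ) (h : Fin d → ℝ) (δ : ℝ) : Set (Pt d) :=
  {y | ξ (ctR y) - inr h (ctR y) < δ * ξ (ctR y)}

/-- `γ(k)` is an `(h,δ)`-cone point of `γ`: the whole path lies in the union of the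
forward and backward cones of aperture `3δ` centred at `γ(k)`. -/
def IsConePt (ξ : (Fin d → ℝ) → ℝ) (h : Fin d → ℝ) (δ : ℝ) (γ : List (Pt d)) (k : ℕ) : Prop :=
  k ≤ γ.length ∧ ∀ j ≤ γ.length, j ≠ k →
    ((pos γ j - pos γ k) ∈ Ygt ξ h (3 * δ) ∨ (pos γ k - pos γ j) ∈ Ygt ξ h (3 * δ))

open scoped Classical in
/-- The number of `(h,δ)`-cone points of the path `γ`. -/
def coneCount (ξ : (Fin d → ℝ) → ℝ) (h : Fin d → ℝ) (δ : ℝ) (γ : List (Pt d)) : ℕ :=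
  ((Finset.range (γ.length + 1)).filter (fun k => IsConePt ξ h δ γ k)).card

/-- Unoriented edges traversed by the path `γ` started at the point `a`. -/
def pathEdges (a : Pt d) (γ : List (Pt d)) : Set (Sym2 (Pt d)) :=
  {e | ∃ k < γ.length, e = s(a + pos γ k, a + pos γ (k + 1))}

/-- Starting point of the `i`-th piece in the concatenation of the paths `γv 0, …, γv (m-1)`. -/
def famStart {m : ℕ} (γv : Fin m → List (Pt d)) (i : Fin m) : Pt d :=
  ∑ j ∈ Finset.univ.filter (fun j : Fin m => j < i), disp (γv j)

/-- The pieces `γv 0, …, γv (m-1)` of a concatenation are edge-disjoint. -/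
def EdgeDisjointFam {m : ℕ} (γv : Fin m → List (Pt d)) : Prop :=
  ∀ i j : Fin m, i ≠ j →
    Disjoint (pathEdges (famStart γv i) (γv i)) (pathEdges (famStart γv j) (γv j))

/-- Concatenation `γ₁ ∪ ⋯ ∪ γ_m` of paths (as step lists). -/
def concatFam {m : ℕ} (γv : Fin m → List (Pt d)) : List (Pt d) := (List.ofFn γv).flatten

/-- Perturbed weight `e^{-Φ(γ) - R(γ,g) + (g, D(γ))}`. -/
def wPert (φ : ℕ → ℝ≥0∞) (Rp : List (Pt d) → (Fin d → ℝ) → ℝ) (g : Fin d → ℝ)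
    (γ : List (Pt d)) : ℝ≥0∞ :=
  expNegE (PotE φ γ) * ENNReal.ofReal (Real.exp (-Rp γ g + inr g (ctR (disp γ))))

/-- Perturbed partition function `Z̃_n^g`. -/
def ZPert (d : ℕ) (φ : ℕ → ℝ≥0∞) (Rp : List (Pt d) → (Fin d → ℝ) → ℝ)
    (g : Fin d → ℝ) (n : ℕ) : ℝ≥0∞ :=
  ∑' γ : PathsN d n, wPert φ Rp g (γ : List (Pt d))

/-- The segment of `γ` of length `p` started at time `l` matches the pattern
`(u 0, …, u p)` up to a shift. -/
def patMatch (u : ℕ → Pt d) (p : ℕ) (γ : List (Pt d)) (l : ℕ) : Prop :=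
  ∀ j ≤ p, pos γ (l + j) - pos γ l = u j - u 0

open scoped Classical in
/-- Number of occurrences `N_η(γ)` of the pattern `η = (u 0, …, u p)` in `γ`. -/
def Npat (u : ℕ → Pt d) (p : ℕ) (γ : List (Pt d)) : ℕ :=
  ((Finset.range (γ.length + 1 - p)).filter (fun l => patMatch u p γ l)).card

/-- The gradient vector of `f : ℝ^d → ℝ` at `g`. -/
def gradVec (f : (Fin d → ℝ) → ℝ) (g : Fin d → ℝ) : Fin d → ℝ :=
  fun i => fderiv ℝ f g (Pi.single i 1)

end SIRW

open SIRW


namespace SIRWProof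

/-- The `2d` unit steps. -/
def st {d : ℕ} (p : Fin d × Bool) : Pt d := Pi.single p.1 (if p.2 then 1 else -1)

lemma st_isStep {d : ℕ} (p : Fin d × Bool) : IsStep (st p) := by
  unfold IsStep st
  rw [Finset.sum_eq_single p.1]
  · rcases p with ⟨i, b⟩; cases b <;> simp
  · intro j _ hj; simp [hj]
  · simp

lemma st_inj {d : ℕ} : Function.Injective (st (d := d)) := by
  rintro ⟨i, b⟩ ⟨j, c⟩ h
  unfold st at h
  have h1 := congrFun h i
  by_cases hij : i = j
  · subst hij
    cases b <;> cases c <;> simp at h1 ⊢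
  · cases b <;> simp [Pi.single_apply, hij] at h1

lemma exists_st {d : ℕ} (s : Pt d) (hs : IsStep s) : ∃ p, st p = s := by
  unfold IsStep at hs
  have hne : ∃ i, s i ≠ 0 := by
    by_contra h
    push Not at h
    simp [h] at hs
  obtain ⟨i, hi⟩ := hne
  have h1 : (1 : ℤ) ≤ |s i| := Int.one_le_abs hi
  have h2 := Finset.add_sum_erase Finset.univ (fun j => |s j|) (Finset.mem_univ i)
  have h3 : 0 ≤ ∑ j ∈ Finset.univ.erase i, |s j| := Finset.sum_nonneg (fun _ _ => abs_nonneg _)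
  have h4 : ∑ j ∈ Finset.univ.erase i, |s j| = 0 := by omega
  have h5 : |s i| = 1 := by omega
  rw [Finset.sum_eq_zero_iff_of_nonneg (fun _ _ => abs_nonneg _)] at h4
  have h6 : ∀ j, j ≠ i → s j = 0 := fun j hj => by
    have := h4 j (by simp [hj])
    simpa using this
  rcases (abs_eq (by norm_num : (0:ℤ) ≤ 1)).1 h5 with h | h
  · refine ⟨(i, true), ?_⟩
    funext j
    by_cases hj : j = i
    · subst hj; simp [st, h]
    · simp [st, hj, h6 j hj]
  · refine ⟨(i, false), ?_⟩
    funext j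
    by_cases hj : j = i
    · subst hj; simp [st, h]
    · simp [st, hj, h6 j hj]

open scoped Classical in
/-- Paths of length `n` started at `x` and staying in `S`. -/
def cp {d : ℕ} (S : Set (Pt d)) : ℕ → Pt d → Finset (List (Pt d))
  | 0, x => if x ∈ S then {[]} else ∅
  | n + 1, x => if x ∈ S then
      Finset.univ.biUnion (fun p : Fin d × Bool => (cp S n (x + st p)).image (List.cons (st p)))
      else ∅

lemma mem_cp {d : ℕ} (S : Set (Pt d)) (n : ℕ) : ∀ (x : Pt d) (γ : List (Pt d)),
    γ ∈ cp S n x ↔ IsPath γ ∧ γ.length = n ∧ ∀ k ≤ n, x + pos γ k ∈ S := by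
  induction n with
  | zero =>
    intro x γ
    unfold cp
    by_cases hx : x ∈ S
    · simp only [hx, if_true, Finset.mem_singleton]
      constructor
      · rintro rfl
        simp [IsPath, pos, hx]
      · rintro ⟨_, h, _⟩
        exact List.length_eq_zero_iff.1 h
    · simp only [hx, if_false, Finset.notMem_empty, false_iff]
      rintro ⟨_, _, h⟩
      have := h 0 le_rfl
      simp [pos] at this
      exact hx this
  | succ n ih =>
    intro x γ
    unfold cp
    by_cases hx : x ∈ S
    · simp only [hx, if_true, Finset.mem_biUnion, Finset.mem_univ, true_and, Finset.mem_image]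
      constructor
      · rintro ⟨p, γ', h, rfl⟩
        rw [ih] at h
        obtain ⟨h1, h2, h3⟩ := h
        refine ⟨?_, by simp [h2], ?_⟩
        · intro s hs
          rcases List.mem_cons.1 hs with rfl | hs
          · exact st_isStep p
          · exact h1 s hs
        · intro k hk
          cases k with
          | zero => simpa [pos] using hx
          | succ k =>
            have := h3 k (by omega)
            simpa [pos, add_assoc] using this
      · rintro ⟨h1, h2, h3⟩
        cases γ with
        | nil => simp at h2
        | cons s γ' =>
          obtain ⟨p, rfl⟩ := exists_st s (h1 s (by simp))
          refine ⟨p, γ', ?_, rfl⟩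
          rw [ih]
          refine ⟨fun s hs => h1 s (by simp [hs]), by simpa using h2, ?_⟩
          intro k hk
          have := h3 (k + 1) (by omega)
          simpa [pos, add_assoc] using this
    · simp only [hx, if_false, Finset.notMem_empty, false_iff]
      rintro ⟨_, _, h⟩
      have := h 0 (by omega)
      simp [pos] at this
      exact hx this

lemma card_cp_succ {d : ℕ} (S : Set (Pt d)) (n : ℕ) (x : Pt d) (hx : x ∈ S) :
    (cp S (n + 1) x).card = ∑ p : Fin d × Bool, (cp S n (x + st p)).card := by
  rw [cp, if_pos hx, Finset.card_biUnion]
  · refine Finset.sum_congr rfl fun p _ => ?_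
    exact Finset.card_image_of_injective _ (List.cons_injective)
  · intro p _ q _ hpq
    rw [Function.onFun_apply]
    rw [Finset.disjoint_left]
    intro γ h1 h2
    simp only [Finset.mem_image] at h1 h2
    obtain ⟨a, _, rfl⟩ := h1
    obtain ⟨b, _, h⟩ := h2
    simp only [List.cons.injEq] at h
    exact hpq (st_inj h.1).symm

lemma card_cp_univ {d : ℕ} (n : ℕ) : ∀ (x : Pt d),
    (cp (Set.univ : Set (Pt d)) n x).card = (2 * d) ^ n := by
  induction n with
  | zero => intro x; simp [cp]
  | succ n ih =>
    intro x
    rw [card_cp_succ _ _ _ (Set.mem_univ _)]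
    simp [ih, pow_succ]
    ring

lemma card_cp_lower {d : ℕ} (S : Set (Pt d)) (v : Pt d → ℝ) (ν : ℝ) (hν : 0 ≤ ν)
    (hv1 : ∀ x, v x ≤ 1) (hv0 : ∀ x, x ∉ S → v x ≤ 0)
    (hv : ∀ x ∈ S, ν * v x ≤ ∑ p : Fin d × Bool, v (x + st p)) (n : ℕ) :
    ∀ x, ν ^ n * v x ≤ ((cp S n x).card : ℝ) := by
  induction n with
  | zero =>
    intro x
    by_cases hx : x ∈ S
    · simpa [cp, hx] using hv1 x
    · simpa [cp, hx] using hv0 x hx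
  | succ n ih =>
    intro x
    by_cases hx : x ∈ S
    · rw [card_cp_succ _ _ _ hx]
      push_cast
      calc ν ^ (n + 1) * v x = ν ^ n * (ν * v x) := by ring
        _ ≤ ν ^ n * ∑ p : Fin d × Bool, v (x + st p) :=
          mul_le_mul_of_nonneg_left (hv x hx) (pow_nonneg hν n)
        _ = ∑ p : Fin d × Bool, ν ^ n * v (x + st p) := by rw [Finset.mul_sum]
        _ ≤ _ := Finset.sum_le_sum fun p _ => ih _
    · have : ν ^ (n + 1) * v x ≤ 0 :=
        mul_nonpos_of_nonneg_of_nonpos (pow_nonneg hν _) (hv0 x hx)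
      exact this.trans (Nat.cast_nonneg _)

/-- product of cosines -/
def uu {d : ℕ} (a : ℝ) (x : Pt d) : ℝ := ∏ j, Real.cos (a * x j)

lemma uu_sum {d : ℕ} (a : ℝ) (x : Pt d) :
    ∑ p : Fin d × Bool, uu a (x + st p) = 2 * d * Real.cos a * uu a x := by
  rw [Fintype.sum_prod_type]
  have key : ∀ i : Fin d, ∑ b : Bool, uu a (x + st (i, b)) = 2 * Real.cos a * uu a x := by
    intro i
    have h0 : uu a x = Real.cos (a * x i) * ∏ j ∈ Finset.univ.erase i, Real.cos (a * x j) :=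
      (Finset.mul_prod_erase Finset.univ (fun j => Real.cos (a * x j)) (Finset.mem_univ i)).symm
    have h1 : ∀ b, uu a (x + st (i, b)) = Real.cos (a * (x i + if b then 1 else -1)) *
        ∏ j ∈ Finset.univ.erase i, Real.cos (a * x j) := by
      intro b
      unfold uu
      rw [← Finset.mul_prod_erase Finset.univ _ (Finset.mem_univ i)]
      congr 1
      · cases b <;> simp [st]
      · refine Finset.prod_congr rfl fun j hj => ?_
        have hj : j ≠ i := Finset.ne_of_mem_erase hj
        simp [st, hj]
    rw [Fintype.sum_bool, h1, h1, h0]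
    simp only [if_true, Bool.false_eq_true, if_false]
    rw [mul_add, mul_add, mul_one, Real.cos_add, mul_neg_one, Real.cos_add, Real.cos_neg, Real.sin_neg]
    ring
  rw [Finset.sum_congr rfl fun i _ => key i]
  simp
  ring

lemma uu_le_one {d : ℕ} (a : ℝ) (x : Pt d) : uu a x ≤ 1 := by
  refine (le_abs_self _).trans ?_
  unfold uu
  rw [Finset.abs_prod]
  exact Finset.prod_le_one (fun _ _ => abs_nonneg _) (fun _ _ => Real.abs_cos_le_one _)

lemma box_lower {d : ℕ} (L : ℕ) (n : ℕ) (a : ℝ) (ha : a * (L + 1) = Real.pi / 2)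
    (hc : 0 ≤ Real.cos a) :
    (2 * d * Real.cos a) ^ n ≤
      ((cp {x : Pt d | ∀ i, |x i| ≤ (L : ℤ)} n 0).card : ℝ) := by
  classical
  set S := {x : Pt d | ∀ i, |x i| ≤ (L : ℤ)} with hS
  have h := card_cp_lower S (fun x => if x ∈ S then uu a x else 0) (2 * d * Real.cos a)
    (by positivity) ?_ ?_ ?_ n 0
  · have h0 : (0 : Pt d) ∈ S := by simp [hS]
    simpa [h0, uu] using h
  · intro x
    split_ifs
    · exact uu_le_one a x
    · norm_num
  · intro x hx
    simp [hx]
  · intro x hx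
    simp only [hx, if_true]
    rw [← uu_sum]
    refine Finset.sum_le_sum fun p _ => ?_
    split_ifs with h
    · exact le_rfl
    · refine le_of_eq ?_
      unfold uu
      obtain ⟨i, b⟩ := p
      have hi : |(x + st (i, b)) i| = (L : ℤ) + 1 := by
        have h' : ∃ j, (L : ℤ) < |(x + st (i, b)) j| := by
          by_contra hh
          push Not at hh
          exact h hh
        obtain ⟨j, hj⟩ := h'
        have hxj := hx j
        by_cases hji : j = i
        · subst hji
          have : |(x + st (j, b)) j| ≤ |x j| + 1 := by
            refine (abs_add_le _ _).trans ?_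
            cases b <;> simp [st]
          omega
        · simp [st, hji] at hj
          omega
      refine Finset.prod_eq_zero (Finset.mem_univ i) ?_
      rw [← Real.cos_abs, abs_mul, ← Int.cast_abs, hi]
      push_cast
      have hapos : 0 < a := by
        by_contra hneg
        have h1 : a * (L + 1) ≤ 0 := mul_nonpos_of_nonpos_of_nonneg (not_lt.1 hneg) (by positivity)
        have := Real.pi_pos
        linarith
      rw [abs_of_pos hapos, ha, Real.cos_pi_div_two]

/-- the Euclidean ball -/
def ball (d : ℕ) (R : ℝ) : Set (Pt d) := {x | nrm (ctR x) ≤ R}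

lemma one_le_card {d : ℕ} (hd : 1 ≤ d) (R : ℝ) (hR : 1 ≤ R) (n : ℕ) :
    (1 : ℝ) ≤ ((cp (ball d R) n 0).card : ℝ) := by
  classical
  set p0 : Fin d × Bool := (⟨0, hd⟩, true)
  set p1 : Fin d × Bool := (⟨0, hd⟩, false)
  have hp : st p0 + st p1 = 0 := by
    funext j
    by_cases hj : j = ⟨0, hd⟩ <;> simp [st, p0, p1, hj]
  have h0 : (0 : Pt d) ∈ ball d R := by
    simp [ball, nrm, ctR]; linarith
  have h1 : st p0 ∈ ball d R := by
    have : ∑ i, ((st p0 i : ℤ) : ℝ) ^ 2 = 1 := by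
      rw [Finset.sum_eq_single ⟨0, hd⟩]
      · simp [st, p0]
      · intro j _ hj; simp [st, p0, hj]
      · simp
    simp only [ball, nrm, ctR, Set.mem_ofPred_eq, this, Real.sqrt_one, hR]
  have hnn : ∀ y, (0:ℝ) ≤ (if y = 0 ∨ y = st p0 then (1 : ℝ) else 0) := by
    intro y; split_ifs <;> norm_num
  have h := card_cp_lower (ball d R) (fun x => if x = 0 ∨ x = st p0 then (1 : ℝ) else 0) 1
    zero_le_one ?_ ?_ ?_ n 0
  · simpa using h
  · intro x; split_ifs <;> norm_num
  · intro x hx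
    have : ¬ (x = 0 ∨ x = st p0) := by
      rintro (rfl | rfl)
      · exact hx h0
      · exact hx h1
    simp [this]
  · intro x _
    by_cases hx : x = 0 ∨ x = st p0
    · simp only [hx, if_true, one_mul]
      rcases hx with rfl | rfl
      · refine le_trans ?_ (Finset.single_le_sum (fun p _ => hnn _) (Finset.mem_univ p0))
        simp
      · refine le_trans ?_ (Finset.single_le_sum (fun p _ => hnn _) (Finset.mem_univ p1))
        simp [hp]
    · simp only [hx, if_false, mul_zero]
      exact Finset.sum_nonneg fun p _ => hnn _

lemma cp_mono {d : ℕ} {S T : Set (Pt d)} (h : S ⊆ T) (n : ℕ) (x : Pt d) :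
    cp S n x ⊆ cp T n x := by
  intro γ hγ
  rw [mem_cp] at hγ ⊢
  exact ⟨hγ.1, hγ.2.1, fun k hk => h (hγ.2.2 k hk)⟩

/-- the dimensional constant -/
def cc (d : ℕ) : ℝ := d * (Real.log (2 * d) + 3)

lemma cc_pos {d : ℕ} (hd : 1 ≤ d) : 0 < cc d := by
  have : (1 : ℝ) ≤ d := by exact_mod_cast hd
  have h2 : 0 ≤ Real.log (2 * d) := Real.log_nonneg (by linarith)
  unfold cc
  positivity

lemma confine {d : ℕ} (hd : 1 ≤ d) (n : ℕ) (R : ℝ) (hR : 1 ≤ R) :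
    (2 * (d : ℝ)) ^ n * Real.exp (-cc d * n / R ^ 2) ≤ ((cp (ball d R) n 0).card : ℝ) := by
  have hd1 : (1 : ℝ) ≤ d := by exact_mod_cast hd
  have hlog : 0 ≤ Real.log (2 * d) := Real.log_nonneg (by linarith)
  have hR2 : 0 < R ^ 2 := by positivity
  have hexp : Real.exp (-cc d * n / R ^ 2) = Real.exp (-cc d / R ^ 2) ^ n := by
    rw [← Real.exp_nat_mul]; congr 1; ring
  rw [hexp, ← mul_pow]
  by_cases hcase : R ^ 2 < d
  · refine le_trans (pow_le_one₀ (by positivity) ?_) (one_le_card hd R hR n)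
    have h1 : Real.log (2 * d) ≤ cc d / R ^ 2 := by
      rw [le_div_iff₀ hR2]
      unfold cc
      nlinarith
    calc 2 * (d : ℝ) * Real.exp (-cc d / R ^ 2)
        ≤ 2 * (d : ℝ) * Real.exp (-Real.log (2 * d)) := by
          gcongr
          rw [neg_div]
          linarith
      _ = 1 := by
          rw [Real.exp_neg, Real.exp_log (by positivity)]
          field_simp
  · push Not at hcase
    have hsd : 0 < Real.sqrt d := Real.sqrt_pos.2 (by linarith)
    have hsq : Real.sqrt d ^ 2 = d := Real.sq_sqrt (by linarith)
    set q := R / Real.sqrt d with hq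
    have hqR : q ^ 2 * d = R ^ 2 := by
      rw [hq, div_pow, hsq]; field_simp
    have hq0 : 0 < q := by positivity
    have hq1 : 1 ≤ q := by
      rw [hq, one_le_div hsd]
      exact Real.sqrt_le_iff.2 ⟨by linarith, hcase⟩
    set L := ⌊q⌋₊ with hL
    have hL1 : 1 ≤ L := Nat.le_floor (by simpa using hq1)
    have hL1' : (1 : ℝ) ≤ L := by exact_mod_cast hL1
    have hLq : (L : ℝ) ≤ q := Nat.floor_le hq0.le
    have hqL : q < L + 1 := Nat.lt_floor_add_one q
    set a := Real.pi / 2 / (L + 1) with haa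
    have ha : a * (L + 1) = Real.pi / 2 := by rw [haa]; field_simp
    have hapos : 0 < a := by have := Real.pi_pos; positivity
    have hpi : Real.pi < 3.15 := Real.pi_lt_d2
    have ha1 : a ^ 2 ≤ 1 := by
      have : a * 2 ≤ Real.pi / 2 := by
        rw [← ha]; gcongr; linarith
      have : a ≤ 1 := by linarith
      nlinarith
    have haq : a * q ≤ 1.6 := by
      have : a * q ≤ a * (L + 1) := by gcongr
      linarith
    have ha2 : a ^ 2 ≤ 3 * d / R ^ 2 := by
      rw [le_div_iff₀ hR2, ← hqR]
      have : (a * q) ^ 2 ≤ 3 := by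
        have : 0 < a * q := by positivity
        nlinarith
      nlinarith
    have hcos : Real.exp (-cc d / R ^ 2) ≤ Real.cos a := by
      have h1 := Real.one_sub_sq_div_two_le_cos (x := a)
      have h2 : Real.exp (-cc d / R ^ 2) ≤ Real.exp (- a ^ 2) := by
        apply Real.exp_le_exp.2
        rw [neg_div]
        have : 3 * d / R ^ 2 ≤ cc d / R ^ 2 := by
          gcongr
          unfold cc
          nlinarith
        linarith
      have h3 : Real.exp (-a ^ 2) ≤ 1 - a ^ 2 / 2 := by
        rw [Real.exp_neg, inv_le_comm₀ (Real.exp_pos _) (by linarith)]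
        refine le_trans ?_ (Real.add_one_le_exp (a ^ 2))
        rw [inv_le_iff_one_le_mul₀ (by linarith)]
        nlinarith [sq_nonneg a]
      linarith
    have hsub : {x : Pt d | ∀ i, |x i| ≤ (L : ℤ)} ⊆ ball d R := by
      intro x hx
      simp only [ball, nrm, ctR, Set.mem_ofPred_eq]
      refine Real.sqrt_le_iff.2 ⟨by linarith, ?_⟩
      calc ∑ i, ((x i : ℤ) : ℝ) ^ 2 ≤ ∑ i : Fin d, q ^ 2 := by
            refine Finset.sum_le_sum fun i _ => ?_
            have h1 : |((x i : ℤ) : ℝ)| ≤ L := by exact_mod_cast hx i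
            rw [← sq_abs]
            gcongr
            linarith
        _ = R ^ 2 := by simp [← hqR]; ring
    calc (2 * (d : ℝ) * Real.exp (-cc d / R ^ 2)) ^ n
        ≤ (2 * d * Real.cos a) ^ n := by gcongr
      _ ≤ _ := box_lower L n a ha ((Real.exp_pos _).le.trans hcos)
      _ ≤ _ := by exact_mod_cast Finset.card_le_card (cp_mono hsub n 0)

lemma ball_finite (d : ℕ) (R : ℝ) : (ball d R).Finite := by
  refine (Set.finite_Icc (fun _ : Fin d => -⌈R⌉) (fun _ => ⌈R⌉)).subset ?_
  intro x hx
  have h : ∀ i, |((x i : ℤ) : ℝ)| ≤ R := by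
    intro i
    refine le_trans ?_ hx
    simp only [nrm, ctR]
    rw [← Real.sqrt_sq_eq_abs]
    exact Real.sqrt_le_sqrt (Finset.single_le_sum (f := fun i => ((x i : ℤ) : ℝ) ^ 2)
      (fun _ _ => sq_nonneg _) (Finset.mem_univ i))
  have h' : ∀ i, |x i| ≤ ⌈R⌉ := fun i => by
    have := (h i).trans (Int.le_ceil R)
    exact_mod_cast this
  exact ⟨fun i => (abs_le.1 (h' i)).1, fun i => (abs_le.1 (h' i)).2⟩

lemma locTime_le {d : ℕ} (γ : List (Pt d)) (hγ : IsPath γ) (hn : 1 ≤ γ.length) (x : Pt d) :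
    locTime γ x ≤ γ.length := by
  unfold locTime
  have : ((Finset.range (γ.length + 1)).filter (fun k => pos γ k = x)) ⊂
      Finset.range (γ.length + 1) := by
    rw [Finset.ssubset_iff_subset_ne]
    refine ⟨Finset.filter_subset _ _, fun h => ?_⟩
    rw [Finset.filter_eq_self] at h
    have h0 := h 0 (by simp)
    have h1 := h 1 (by simp; omega)
    cases γ with
    | nil => simp at hn
    | cons s γ =>
      simp [pos] at h0 h1
      have := hγ s (by simp)
      rw [h1, ← h0] at this
      simp [IsStep] at this
  have := Finset.card_lt_card this
  rw [Finset.card_range] at this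
  omega

lemma PotR_le {d : ℕ} (φ : ℕ → ℝ) (hpos : ∀ n, 0 ≤ φ n) (hmono : Monotone φ) (R : ℝ) (n : ℕ)
    (hn : 1 ≤ n) (γ : List (Pt d)) (hγ : γ ∈ cp (ball d R) n 0) :
    PotR φ γ ≤ (Nat.card {x : Pt d // nrm (ctR x) ≤ R} : ℝ) * φ n := by
  rw [mem_cp] at hγ
  obtain ⟨h1, h2, h3⟩ := hγ
  unfold PotR
  calc ∑ x ∈ visited γ, φ (locTime γ x) ≤ ∑ x ∈ visited γ, φ n :=
        Finset.sum_le_sum fun x _ => hmono (h2 ▸ locTime_le γ h1 (by omega) x)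
    _ = ((visited γ).card : ℝ) * φ n := by simp
    _ ≤ _ := by
      refine mul_le_mul_of_nonneg_right ?_ (hpos n)
      have hs : ((visited γ : Finset (Pt d)) : Set (Pt d)) ⊆ ball d R := by
        intro x hx
        simp only [visited, Finset.coe_image, Set.mem_image, Finset.coe_range, Set.mem_Iio] at hx
        obtain ⟨k, hk, rfl⟩ := hx
        simpa using h3 k (by omega)
      have := Set.ncard_le_ncard hs (ball_finite d R)
      rw [Set.ncard_coe_finset] at this
      exact_mod_cast this

lemma pathsN_eq (d n : ℕ) : PathsN d n = (cp (Set.univ : Set (Pt d)) n 0 : Set (List (Pt d))) := by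
  ext γ
  simp [PathsN, mem_cp]

lemma ZR_eq (d n : ℕ) (φ : ℕ → ℝ) : ZR d φ n =
    ∑ γ ∈ cp (Set.univ : Set (Pt d)) n 0, ENNReal.ofReal (Real.exp (-PotR φ γ)) := by
  unfold ZR
  rw [pathsN_eq]
  exact Finset.tsum_subtype (cp (Set.univ : Set (Pt d)) n 0)
    (fun γ => ENNReal.ofReal (Real.exp (-PotR φ γ)))

lemma ZR_upper (d n : ℕ) (φ : ℕ → ℝ) (hpos : ∀ n, 0 ≤ φ n) :
    ZR d φ n ≤ ((2 * d : ℕ) : ℝ≥0∞) ^ n := by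
  rw [ZR_eq]
  calc _ ≤ ∑ γ ∈ cp (Set.univ : Set (Pt d)) n 0, (1 : ℝ≥0∞) := by
        refine Finset.sum_le_sum fun γ _ => ?_
        rw [ENNReal.ofReal_le_one, Real.exp_le_one_iff, neg_nonpos]
        exact Finset.sum_nonneg fun x _ => hpos _
    _ = _ := by
        rw [Finset.sum_const, card_cp_univ]
        simp

lemma ZR_lower {d : ℕ} (hd : 1 ≤ d) (φ : ℕ → ℝ) (hpos : ∀ n, 0 ≤ φ n) (hmono : Monotone φ)
    (R : ℝ) (hR : 1 ≤ R) (n : ℕ) (hn : 1 ≤ n) :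
    (2 * (d : ℝ)) ^ n * Real.exp (-cc d * n / R ^ 2) *
      Real.exp (-((Nat.card {x : Pt d // nrm (ctR x) ≤ R} : ℝ) * φ n)) ≤ (ZR d φ n).toReal := by
  have hZ : (ZR d φ n).toReal =
      ∑ γ ∈ cp (Set.univ : Set (Pt d)) n 0, Real.exp (-PotR φ γ) := by
    rw [ZR_eq, ENNReal.toReal_sum (fun _ _ => ENNReal.ofReal_ne_top)]
    exact Finset.sum_congr rfl fun γ _ => ENNReal.toReal_ofReal (Real.exp_pos _).le
  rw [hZ]
  calc _ ≤ ((cp (ball d R) n 0).card : ℝ) *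
        Real.exp (-((Nat.card {x : Pt d // nrm (ctR x) ≤ R} : ℝ) * φ n)) := by
        gcongr
        exact confine hd n R hR
    _ = ∑ γ ∈ cp (ball d R) n 0,
          Real.exp (-((Nat.card {x : Pt d // nrm (ctR x) ≤ R} : ℝ) * φ n)) := by simp
    _ ≤ ∑ γ ∈ cp (ball d R) n 0, Real.exp (-PotR φ γ) := by
        refine Finset.sum_le_sum fun γ hγ => ?_
        rw [Real.exp_le_exp, neg_le_neg_iff]
        exact PotR_le φ hpos hmono R n hn γ hγ
    _ ≤ _ := Finset.sum_le_sum_of_subset_of_nonneg (cp_mono (Set.subset_univ _) n 0)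
        fun _ _ _ => (Real.exp_pos _).le

lemma logZ_lower {d : ℕ} (hd : 1 ≤ d) (φ : ℕ → ℝ) (hpos : ∀ n, 0 ≤ φ n) (hmono : Monotone φ)
    (R : ℝ) (hR : 1 ≤ R) (n : ℕ) (hn : 1 ≤ n) :
    Real.log (2 * (d : ℝ)) - cc d / R ^ 2 -
            (Nat.card {x : Pt d // nrm (ctR x) ≤ R} : ℝ) * φ n / n ≤
          Real.log (ZR d φ n).toReal / n := by
  have h := ZR_lower hd φ hpos hmono R hR n hn
  have hd0 : (0 : ℝ) < 2 * d := by
    have : (1 : ℝ) ≤ d := by exact_mod_cast hd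
    linarith
  have hn0 : (0 : ℝ) < n := by exact_mod_cast hn
  have h2 := Real.log_le_log (by positivity) h
  rw [Real.log_mul (by positivity) (Real.exp_pos _).ne',
    Real.log_mul (by positivity) (Real.exp_pos _).ne', Real.log_pow, Real.log_exp,
    Real.log_exp] at h2
  rw [le_div_iff₀ hn0]
  refine le_trans (le_of_eq ?_) h2
  field_simp
  ring

lemma logZ_upper {d : ℕ} (hd : 1 ≤ d) (φ : ℕ → ℝ) (hpos : ∀ n, 0 ≤ φ n) (hmono : Monotone φ)
    (n : ℕ) (hn : 1 ≤ n) :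
    Real.log (ZR d φ n).toReal / n ≤ Real.log (2 * (d : ℝ)) := by
  have hd0 : (0 : ℝ) < 2 * d := by
    have : (1 : ℝ) ≤ d := by exact_mod_cast hd
    linarith
  have hn0 : (0 : ℝ) < n := by exact_mod_cast hn
  have h0 : 0 < (ZR d φ n).toReal :=
    lt_of_lt_of_le (by positivity) (ZR_lower hd φ hpos hmono 1 le_rfl n hn)
  have h1 : (ZR d φ n).toReal ≤ (2 * (d : ℝ)) ^ n := by
    have := ENNReal.toReal_mono (by finiteness) (ZR_upper d n φ hpos)
    simpa using this
  rw [div_le_iff₀ hn0, mul_comm, ← Real.log_pow]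
  exact Real.log_le_log h0 h1

end SIRWProof

/-- attractive case with (SL): the connectivity constant equals `log (2d)`;
moreover `Z_n ≤ (2d)^n` and there is a dimensional constant `c(d) > 0`, arising from the
confinement estimate for the simple random walk in the ball `B_R`, such that
`(1/n) log Z_n ≥ log (2d) - c/R² - |B_R ∩ ℤ^d| φ(n)/n` for all `R ≥ 1`, `n ≥ 1`. -/
theorem stmt2 (d : ℕ) (hd : 1 ≤ d) (φ : ℕ → ℝ)
    (hpos : ∀ n, 0 ≤ φ n) (hN0 : φ 0 = 0) (hNmono : Monotone φ)
    (hA : ∀ l m : ℕ, φ (l + m) ≤ φ l + φ m)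
    (hSL : Filter.Tendsto (fun n : ℕ => φ n / n) Filter.atTop (nhds 0)) :
    Filter.Tendsto (fun n : ℕ => Real.log (ZR d φ n).toReal / n) Filter.atTop
      (nhds (Real.log (2 * (d : ℝ)))) ∧
    (∀ n : ℕ, ZR d φ n ≤ ((2 * d : ℕ) : ℝ≥0∞) ^ n) ∧
    (∃ c : ℝ, 0 < c ∧
      (∀ (n : ℕ) (R : ℝ), 1 ≤ R →
        (2 * (d : ℝ)) ^ n * Real.exp (-c * n / R ^ 2) ≤
          (Nat.card {γ : List (Pt d) //
            IsPath γ ∧ γ.length = n ∧ ∀ k ≤ n, nrm (ctR (pos γ k)) ≤ R} : ℝ)) ∧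
      (∀ R : ℝ, 1 ≤ R → ∀ n : ℕ, 1 ≤ n →
        Real.log (2 * (d : ℝ)) - c / R ^ 2 -
            (Nat.card {x : Pt d // nrm (ctR x) ≤ R} : ℝ) * φ n / n ≤
          Real.log (ZR d φ n).toReal / n)) := by

  refine ⟨?_, fun n => SIRWProof.ZR_upper d n φ hpos, SIRWProof.cc d, SIRWProof.cc_pos hd, ?_,
    fun R hR n hn => SIRWProof.logZ_lower hd φ hpos hNmono R hR n hn⟩
  · rw [Metric.tendsto_atTop]
    intro ε hε
    have hc := SIRWProof.cc_pos hd
    obtain ⟨R, hR, hR2⟩ : ∃ R : ℝ, 1 ≤ R ∧ SIRWProof.cc d / R ^ 2 < ε / 2 := by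
      refine ⟨1 + 2 * SIRWProof.cc d / ε, by have : 0 < 2 * SIRWProof.cc d / ε := by positivity
                                             linarith, ?_⟩
      set t := 2 * SIRWProof.cc d / ε with ht
      have ht0 : 0 < t := by positivity
      have hct : SIRWProof.cc d = t * (ε / 2) := by rw [ht]; field_simp
      rw [div_lt_iff₀ (by positivity), hct]
      nlinarith [mul_pos ht0 hε, mul_pos (mul_pos ht0 hε) ht0]
    set K := (Nat.card {x : Pt d // nrm (ctR x) ≤ R} : ℝ) with hK
    have hlim : Filter.Tendsto (fun n : ℕ => K * (φ n / n)) Filter.atTop (nhds 0) := by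
      simpa using hSL.const_mul K
    obtain ⟨N, hN⟩ := (Metric.tendsto_atTop.1 hlim) (ε / 2) (by positivity)
    refine ⟨max N 1, fun n hn => ?_⟩
    have hn1 : 1 ≤ n := le_trans (le_max_right _ _) hn
    have h1 := SIRWProof.logZ_lower hd φ hpos hNmono R hR n hn1
    have h2 := SIRWProof.logZ_upper hd φ hpos hNmono n hn1
    have h3 := hN n (le_trans (le_max_left _ _) hn)
    rw [Real.dist_eq, sub_zero] at h3
    have h4 := (abs_lt.1 h3).2
    rw [← hK, mul_div_assoc] at h1
    rw [Real.dist_eq, abs_lt]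
    constructor <;> linarith
  · intro n R hR
    refine (SIRWProof.confine hd n R hR).trans (le_of_eq ?_)
    rw [← Set.ncard_coe_finset]
    have hset : ((SIRWProof.cp (SIRWProof.ball d R) n 0 : Finset (List (Pt d))) :
        Set (List (Pt d))) =
        {γ | IsPath γ ∧ γ.length = n ∧ ∀ k ≤ n, nrm (ctR (pos γ k)) ≤ R} := by
      ext γ
      simp [SIRWProof.mem_cp, SIRWProof.ball]
    rw [hset]
    rfl
end
end

section
/- Let d ≥ 1 and let φ : ℕ → [0,∞) satisfy φ(0)=0, φ nondecreasing (condition (N)), the attractive condition (A): φ(l+m) ≤ φ(l)+φ(m), and the normalisation (SL): φ(n)/n → 0 (so that λ₀ = log(2d)). Then for every λ > λ₀ and every x ∈ ℤ^d, D_λ(x) ≤ H_λ(x) · Σ_{η : 0→0} e^{−λ|η|}, where the sum runs over all nearest-neighbour loops η at the origin and is finite for λ > log(2d). Consequently, for every λ > λ₀ and x ∈ ℝ^d, −lim_{M→∞} (1/M) log D_λ(⌊Mx⌋) exists and equals ξ_λ(x) = −lim_{M→∞} (1/M) log H_λ(⌊Mx⌋). -/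
open scoped BigOperators ENNReal
open Filter Topology

noncomputable section

open SIRW

namespace SIRW

lemma pos_length {d : ℕ} (a : List (Pt d)) : pos a a.length = disp a := by
  simp [pos, disp]

lemma pos_append_left {d : ℕ} (a b : List (Pt d)) {k : ℕ} (hk : k ≤ a.length) :
    pos (a ++ b) k = pos a k := by
  simp [pos, List.take_append_of_le_length hk]

lemma pos_append_right {d : ℕ} (a b : List (Pt d)) (k : ℕ) :
    pos (a ++ b) (a.length + k) = disp a + pos b k := by
  simp [pos, disp, List.take_append, List.take_of_length_le]

lemma disp_append {d : ℕ} (a b : List (Pt d)) : disp (a ++ b) = disp a + disp b := by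
  simp [disp]

lemma isPath_append {d : ℕ} {a b : List (Pt d)} :
    IsPath (a ++ b) ↔ IsPath a ∧ IsPath b := by
  simp only [IsPath, List.mem_append]
  constructor
  · intro h
    exact ⟨fun s hs => h s (Or.inl hs), fun s hs => h s (Or.inr hs)⟩
  · rintro ⟨h1, h2⟩ s (hs | hs)
    · exact h1 s hs
    · exact h2 s hs

lemma locTime_le_append {d : ℕ} (a b : List (Pt d)) (z : Pt d) :
    locTime a z ≤ locTime (a ++ b) z := by
  unfold locTime
  apply Finset.card_le_card
  intro k hk
  simp only [Finset.mem_filter, Finset.mem_range, List.length_append] at hk ⊢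
  refine ⟨by omega, ?_⟩
  rw [pos_append_left a b (by omega)]
  exact hk.2

lemma locTime_append_le {d : ℕ} (a b : List (Pt d)) (z : Pt d) :
    locTime (a ++ b) z ≤ locTime a z + locTime b (z - disp a) := by
  unfold locTime
  rw [← Finset.card_image_of_injective
    ((Finset.range (b.length + 1)).filter (fun k => pos b k = z - disp a))
    (add_right_injective a.length)]
  refine le_trans (Finset.card_le_card ?_) (Finset.card_union_le _ _)
  intro k hk
  simp only [Finset.mem_filter, Finset.mem_range, List.length_append, Finset.mem_union,
    Finset.mem_image] at hk ⊢
  by_cases h : k ≤ a.length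
  · left
    rw [pos_append_left a b h] at hk
    exact ⟨by omega, hk.2⟩
  · right
    refine ⟨k - a.length, ⟨by omega, ?_⟩, by omega⟩
    have h2 := pos_append_right a b (k - a.length)
    rw [show a.length + (k - a.length) = k by omega, hk.2] at h2
    rw [h2]; simp

lemma locTime_eq_zero {d : ℕ} (a : List (Pt d)) (z : Pt d) (h : z ∉ visited a) :
    locTime a z = 0 := by
  unfold locTime
  rw [Finset.card_eq_zero, Finset.filter_eq_empty_iff]
  intro k hk hkz
  exact h (Finset.mem_image.2 ⟨k, hk, hkz⟩)

lemma locTime_le_length {d : ℕ} (a : List (Pt d)) (z : Pt d) :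
    locTime a z ≤ a.length + 1 := by
  unfold locTime
  exact (Finset.card_filter_le _ _).trans (by simp)

lemma PotR_eq_of_subset {d : ℕ} {φ : ℕ → ℝ} (h0 : φ 0 = 0) (a : List (Pt d))
    (T : Finset (Pt d)) (hT : visited a ⊆ T) :
    PotR φ a = ∑ z ∈ T, φ (locTime a z) := by
  unfold PotR
  apply Finset.sum_subset hT
  intro z _ hz
  rw [locTime_eq_zero a z hz, h0]

lemma PotR_nonneg {d : ℕ} {φ : ℕ → ℝ} (hpos : ∀ n, 0 ≤ φ n) (a : List (Pt d)) :
    0 ≤ PotR φ a := Finset.sum_nonneg fun _ _ => hpos _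

lemma PotR_le_append {d : ℕ} {φ : ℕ → ℝ} (h0 : φ 0 = 0)
    (hm : Monotone φ) (a b : List (Pt d)) : PotR φ a ≤ PotR φ (a ++ b) := by
  rw [PotR_eq_of_subset h0 a (visited a ∪ visited (a ++ b)) Finset.subset_union_left,
    PotR_eq_of_subset h0 (a ++ b) (visited a ∪ visited (a ++ b)) Finset.subset_union_right]
  exact Finset.sum_le_sum fun z _ => hm (locTime_le_append a b z)

lemma PotR_append_le {d : ℕ} {φ : ℕ → ℝ} (h0 : φ 0 = 0)
    (hm : Monotone φ) (hA : ∀ l m : ℕ, φ (l + m) ≤ φ l + φ m) (a b : List (Pt d)) :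
    PotR φ (a ++ b) ≤ PotR φ a + PotR φ b := by
  classical
  set T := visited a ∪ visited (a ++ b) ∪ (visited b).image (fun z => z + disp a) with hT
  have hb : visited b ⊆ T.image (fun z => z - disp a) := by
    intro z hz
    refine Finset.mem_image.2 ⟨z + disp a, ?_, by simp⟩
    exact Finset.mem_union_right _ (Finset.mem_image.2 ⟨z, hz, rfl⟩)
  rw [PotR_eq_of_subset h0 a T (by intro z hz; simp [hT, hz]),
    PotR_eq_of_subset h0 (a ++ b) T (by intro z hz; simp [hT, hz]),
    PotR_eq_of_subset h0 b _ hb, Finset.sum_image (fun x _ y _ h => sub_left_injective h),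
    ← Finset.sum_add_distrib]
  exact Finset.sum_le_sum fun z _ => (hm (locTime_append_le a b z)).trans (hA _ _)

/-- characterisation of paths hitting `x` first at the end. -/
lemma mem_Hpaths_iff {d : ℕ} (x : Pt d) (a : List (Pt d)) :
    a ∈ Hpaths x ↔ IsPath a ∧ disp a = x ∧ ∀ k < a.length, pos a k ≠ x := by
  unfold Hpaths
  simp only [Set.mem_ofPred_eq]
  refine and_congr_right fun _ => and_congr_right fun hx => ?_
  have hmem : a.length ∈ (Finset.range (a.length + 1)).filter (fun k => pos a k = x) := by
    simp [pos_length, hx]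
  unfold locTime
  constructor
  · intro h k hk hkx
    have h1 := Finset.card_le_one.1 h.le a.length hmem k (by simp [hkx]; omega)
    omega
  · intro h
    rw [Finset.card_eq_one]
    refine ⟨a.length, ?_⟩
    ext k
    simp only [Finset.mem_filter, Finset.mem_range, Finset.mem_singleton]
    constructor
    · rintro ⟨h1, h2⟩
      by_contra hne
      exact h k (by omega) h2
    · rintro rfl
      exact ⟨by omega, by rw [pos_length, hx]⟩

lemma exists_first_hit {d : ℕ} (x : Pt d) (c : List (Pt d)) (hc : c ∈ Dpaths x) :
    ∃ p : Hpaths x × Dpaths (0 : Pt d), (p.1 : List (Pt d)) ++ (p.2 : List (Pt d)) = c := by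
  classical
  obtain ⟨hp, hd⟩ := hc
  have hex : ∃ k, pos c k = x := ⟨c.length, by rw [pos_length, hd]⟩
  set k := Nat.find hex with hk
  have hkl : k ≤ c.length := Nat.find_min' hex (by rw [pos_length, hd])
  have hkx : pos c k = x := Nat.find_spec hex
  have hsplit : c.take k ++ c.drop k = c := List.take_append_drop k c
  have hpp : IsPath (c.take k) ∧ IsPath (c.drop k) := by
    rw [← isPath_append, hsplit]; exact hp
  have hlen : (c.take k).length = k := by simp [hkl]
  have hdt : disp (c.take k) = x := hkx
  refine ⟨⟨⟨c.take k, ?_⟩, ⟨c.drop k, hpp.2, ?_⟩⟩, hsplit⟩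
  · rw [mem_Hpaths_iff]
    refine ⟨hpp.1, hdt, ?_⟩
    intro j hj hjx
    rw [hlen] at hj
    rw [← pos_append_left (c.take k) (c.drop k) (by omega), hsplit] at hjx
    exact Nat.find_min hex hj hjx
  · have := disp_append (c.take k) (c.drop k)
    rw [hsplit, hd, hdt] at this
    simpa using this

lemma append_inj_H {d : ℕ} (x : Pt d) {a a' b b' : List (Pt d)} (ha : a ∈ Hpaths x)
    (ha' : a' ∈ Hpaths x) (h : a ++ b = a' ++ b') : a = a' ∧ b = b' := by
  rw [mem_Hpaths_iff] at ha ha'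
  apply List.append_inj h
  rcases lt_trichotomy a.length a'.length with hl | hl | hl
  · exfalso
    apply ha'.2.2 _ hl
    rw [← pos_append_left a' b' hl.le, ← h, pos_append_left a b le_rfl, pos_length, ha.2.1]
  · exact hl
  · exfalso
    apply ha.2.2 _ hl
    rw [← pos_append_left a b hl.le, h, pos_append_left a' b' le_rfl, pos_length, ha'.2.1]

lemma D_le_H_mul {d : ℕ} {φ : ℕ → ℝ} (h0 : φ 0 = 0)
    (hm : Monotone φ) (lam : ℝ) (x : Pt d) :
    DRf φ lam x ≤ HRf φ lam x *
        ∑' η : Dpaths (0 : Pt d),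
          ENNReal.ofReal (Real.exp (-(lam * (η : List (Pt d)).length))) := by
  choose F hF using fun c : Dpaths x => exists_first_hit x c.1 c.2
  have hinj : Function.Injective F := by
    intro c c' h
    apply Subtype.ext
    rw [← hF c, ← hF c', h]
  unfold DRf HRf
  rw [← ENNReal.tsum_mul_right]
  simp_rw [← ENNReal.tsum_mul_left]
  rw [← ENNReal.tsum_prod]
  refine le_trans (ENNReal.tsum_le_tsum fun c => ?_) (ENNReal.tsum_comp_le_tsum_of_injective hinj _)
  unfold wR
  rw [← ENNReal.ofReal_mul (Real.exp_nonneg _), ← Real.exp_add]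
  apply ENNReal.ofReal_le_ofReal
  apply Real.exp_le_exp.2
  have h1 := PotR_le_append h0 hm (F c).1.1 (F c).2.1
  have h2 : (c.1.length : ℝ) = (F c).1.1.length + (F c).2.1.length := by
    rw [← hF c]; push_cast [List.length_append]; rfl
  rw [hF c] at h1
  rw [h2]
  linarith

lemma H_mul_D_le {d : ℕ} {φ : ℕ → ℝ} (h0 : φ 0 = 0)
    (hm : Monotone φ) (hA : ∀ l m : ℕ, φ (l + m) ≤ φ l + φ m) (lam : ℝ) (x y : Pt d) :
    HRf φ lam x * DRf φ lam y ≤ DRf φ lam (x + y) := by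
  let G : Hpaths x × Dpaths y → Dpaths (x + y) := fun p =>
    ⟨p.1.1 ++ p.2.1, isPath_append.2 ⟨p.1.2.1, p.2.2.1⟩, by
      rw [disp_append, p.1.2.2.1, p.2.2.2]⟩
  have hinj : Function.Injective G := by
    rintro ⟨a, b⟩ ⟨a', b'⟩ h
    have h' := append_inj_H x a.2 a'.2 (congrArg Subtype.val h)
    exact Prod.ext (Subtype.ext h'.1) (Subtype.ext h'.2)
  unfold DRf HRf
  rw [← ENNReal.tsum_mul_right]
  simp_rw [← ENNReal.tsum_mul_left]
  rw [← ENNReal.tsum_prod]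
  refine le_trans (ENNReal.tsum_le_tsum fun p => ?_) (ENNReal.tsum_comp_le_tsum_of_injective hinj _)
  unfold wR
  rw [← ENNReal.ofReal_mul (Real.exp_nonneg _), ← Real.exp_add]
  apply ENNReal.ofReal_le_ofReal
  apply Real.exp_le_exp.2
  have h1 := PotR_append_le h0 hm hA p.1.1 p.2.1
  simp only [G]
  push_cast [List.length_append]
  linarith

lemma H_le_D {d : ℕ} (φ : ℕ → ℝ) (lam : ℝ) (x : Pt d) : HRf φ lam x ≤ DRf φ lam x :=
  ENNReal.tsum_mono_subtype (wR φ lam) (fun _ h => ⟨h.1, h.2.1⟩)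

/-! ### counting paths -/

/-- the finite set of steps -/
def stepF (d : ℕ) : Finset (Pt d) :=
  (Finset.univ : Finset (Fin d × Bool)).image
    (fun p => Pi.single p.1 (if p.2 then (1 : ℤ) else -1))

lemma mem_stepF {d : ℕ} (s : Pt d) : s ∈ stepF d ↔ IsStep s := by
  unfold stepF IsStep
  simp only [Finset.mem_image, Finset.mem_univ, true_and]
  constructor
  · rintro ⟨⟨i, b⟩, rfl⟩
    rw [Finset.sum_eq_single i]
    · cases b <;> simp
    · intro j _ hj
      simp [Pi.single_eq_of_ne hj]
    · simp
  · intro h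
    obtain ⟨i, hi⟩ : ∃ i, s i ≠ 0 := by
      by_contra! hc
      simp [hc] at h
    rw [← Finset.add_sum_erase _ _ (Finset.mem_univ i)] at h
    have h1 : 1 ≤ |s i| := Int.one_le_abs hi
    have h2 : 0 ≤ ∑ j ∈ Finset.univ.erase i, |s j| := Finset.sum_nonneg fun _ _ => abs_nonneg _
    have h3 : ∑ j ∈ Finset.univ.erase i, |s j| = 0 := by omega
    have h4 : |s i| = 1 := by omega
    rw [Finset.sum_eq_zero_iff_of_nonneg (fun _ _ => abs_nonneg _)] at h3
    have h5 : s = Pi.single i (s i) := by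
      ext j
      by_cases hj : j = i
      · subst hj; simp
      · rw [Pi.single_eq_of_ne hj]
        exact abs_eq_zero.1 (h3 j (by simp [hj]))
    rcases (abs_eq (by norm_num)).1 h4 with h6 | h6
    · exact ⟨(i, true), by rw [h5, h6]; simp⟩
    · exact ⟨(i, false), by rw [h5, h6]; simp⟩

lemma card_stepF (d : ℕ) : (stepF d).card = 2 * d := by
  unfold stepF
  rw [Finset.card_image_of_injective]
  · simp [mul_comm]
  · rintro ⟨i, b⟩ ⟨j, c⟩ h
    have h1 := congrFun h i
    have hij : i = j := by
      by_contra hne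
      simp only [Pi.single_eq_same, Pi.single_eq_of_ne hne] at h1
      cases b <;> simp at h1
    subst hij
    cases b <;> cases c <;> simp at h1 <;> rfl

/-- the finite set of `n`-step paths -/
def pathF (d : ℕ) : ℕ → Finset (List (Pt d))
  | 0 => {[]}
  | n + 1 => (stepF d ×ˢ pathF d n).image (fun p => p.1 :: p.2)

lemma mem_pathF {d : ℕ} (n : ℕ) (a : List (Pt d)) :
    a ∈ pathF d n ↔ IsPath a ∧ a.length = n := by
  induction n generalizing a with
  | zero =>
    simp only [pathF, Finset.mem_singleton, List.length_eq_zero_iff]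
    constructor
    · rintro rfl
      exact ⟨by simp [IsPath], rfl⟩
    · exact fun h => h.2
  | succ n ih =>
    simp only [pathF, Finset.mem_image, Finset.mem_product, Prod.exists]
    constructor
    · rintro ⟨s, b, ⟨hs, hb⟩, rfl⟩
      rw [mem_stepF] at hs
      rw [ih] at hb
      refine ⟨?_, by simp [hb.2]⟩
      intro t ht
      rcases List.mem_cons.1 ht with rfl | ht
      · exact hs
      · exact hb.1 t ht
    · rintro ⟨hp, hl⟩
      cases a with
      | nil => simp at hl
      | cons s b =>
        refine ⟨s, b, ⟨(mem_stepF s).2 (hp s (by simp)), (ih b).2 ⟨?_, by simpa using hl⟩⟩, rfl⟩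
        exact fun t ht => hp t (by simp [ht])

lemma card_pathF (d n : ℕ) : (pathF d n).card = (2 * d) ^ n := by
  induction n with
  | zero => simp [pathF]
  | succ n ih =>
    rw [pathF, Finset.card_image_of_injective, Finset.card_product, ih, card_stepF, pow_succ,
      mul_comm]
    rintro ⟨a, b⟩ ⟨a', b'⟩ h
    simpa using h

lemma pathsN_eq (d n : ℕ) : PathsN d n = (pathF d n : Set (List (Pt d))) := by
  ext a
  rw [Finset.mem_coe, mem_pathF]; rfl

lemma tsum_pathsN (d n : ℕ) (f : List (Pt d) → ℝ≥0∞) :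
    ∑' γ : PathsN d n, f γ = ∑ γ ∈ pathF d n, f γ := by
  rw [pathsN_eq]
  exact Finset.tsum_subtype _ f

lemma sum_all_ne_top (d : ℕ) (hd : 1 ≤ d) (lam : ℝ) (hl : Real.log (2 * (d : ℝ)) < lam) :
    (∑' η : {a : List (Pt d) | IsPath a},
        ENNReal.ofReal (Real.exp (-(lam * (η : List (Pt d)).length)))) ≠ ⊤ := by
  have h2d : (0 : ℝ) < 2 * d := by positivity
  set q : ℝ≥0∞ := ENNReal.ofReal ((2 * d : ℝ) * Real.exp (-lam)) with hq
  have hq1 : q < 1 := by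
    rw [hq, ENNReal.ofReal_lt_one]
    rw [Real.exp_neg, ← div_eq_mul_inv, div_lt_one (Real.exp_pos _)]
    exact (Real.log_lt_iff_lt_exp h2d).1 hl
  let f : List (Pt d) → ℝ≥0∞ := fun a => ENNReal.ofReal (Real.exp (-(lam * a.length)))
  have hsub : {a : List (Pt d) | IsPath a} ⊆ ⋃ n, PathsN d n := by
    intro a ha
    exact Set.mem_iUnion.2 ⟨a.length, ha, rfl⟩
  have h1 : ∑' η : {a : List (Pt d) | IsPath a}, f η ≤ ∑' n : ℕ, q ^ n := by
    refine (ENNReal.tsum_mono_subtype f hsub).trans ?_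
    refine (ENNReal.tsum_iUnion_le_tsum f _).trans ?_
    refine ENNReal.tsum_le_tsum fun n => ?_
    rw [tsum_pathsN]
    have : ∀ a ∈ pathF d n, f a = ENNReal.ofReal (Real.exp (-lam) ^ n) := by
      intro a ha
      rw [mem_pathF] at ha
      simp only [f, ha.2]
      rw [← Real.exp_nat_mul]
      congr 2; ring
    rw [Finset.sum_congr rfl this, Finset.sum_const, card_pathF, hq,
      ← ENNReal.ofReal_pow (by positivity), mul_pow (2 * (d : ℝ)),
      ENNReal.ofReal_mul (by positivity), nsmul_eq_mul]
    apply le_of_eq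
    congr 1
    rw [← ENNReal.ofReal_natCast]
    push_cast
    rfl
  refine ne_top_of_le_ne_top ?_ h1
  rw [ENNReal.tsum_geometric]
  simpa [ENNReal.inv_eq_top, tsub_eq_zero_iff_le] using hq1

lemma wR_le {d : ℕ} {φ : ℕ → ℝ} (hpos : ∀ n, 0 ≤ φ n) (lam : ℝ) (a : List (Pt d)) :
    wR φ lam a ≤ ENNReal.ofReal (Real.exp (-(lam * a.length))) := by
  unfold wR
  apply ENNReal.ofReal_le_ofReal
  apply Real.exp_le_exp.2
  linarith [PotR_nonneg hpos a]

lemma D_le_all {d : ℕ} {φ : ℕ → ℝ} (hpos : ∀ n, 0 ≤ φ n) (lam : ℝ) (x : Pt d) :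
    DRf φ lam x ≤ ∑' η : {a : List (Pt d) | IsPath a},
        ENNReal.ofReal (Real.exp (-(lam * (η : List (Pt d)).length))) := by
  let f : List (Pt d) → ℝ≥0∞ := fun a => ENNReal.ofReal (Real.exp (-(lam * a.length)))
  have h1 : DRf φ lam x ≤ ∑' a : Dpaths x, f a := by
    unfold DRf
    exact ENNReal.tsum_le_tsum fun a => wR_le hpos lam a.1
  have hsub : Dpaths x ⊆ {a : List (Pt d) | IsPath a} := fun _ h => h.1
  exact h1.trans (ENNReal.tsum_mono_subtype f hsub)

lemma exists_path {d : ℕ} (x : Pt d) : ∃ a : List (Pt d), a ∈ Dpaths x := by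
  let S : AddSubgroup (Pt d) :=
    { carrier := {x | ∃ a : List (Pt d), a ∈ Dpaths x}
      zero_mem' := ⟨[], by simp [IsPath], by simp [disp]⟩
      add_mem' := by
        rintro x y ⟨a, ha⟩ ⟨b, hb⟩
        exact ⟨a ++ b, isPath_append.2 ⟨ha.1, hb.1⟩, by rw [disp_append, ha.2, hb.2]⟩
      neg_mem' := by
        rintro x ⟨a, ha⟩
        refine ⟨a.map (fun s => -s), ?_, ?_⟩
        · intro s hs
          obtain ⟨t, ht, rfl⟩ := List.mem_map.1 hs
          simpa [IsStep] using ha.1 t ht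
        · have := ha.2
          simp only [disp] at this ⊢
          rw [← this, List.sum_neg] }
  have h1 : ∀ i : Fin d, (Pi.single i 1 : Pt d) ∈ S := by
    intro i
    refine ⟨[Pi.single i 1], ?_, by simp [disp]⟩
    intro s hs
    rw [List.mem_singleton] at hs
    rw [← mem_stepF, hs]
    exact Finset.mem_image.2 ⟨(i, true), Finset.mem_univ _, by simp⟩
  have h2 : x ∈ S := by
    have : x = ∑ i, x i • (Pi.single i 1 : Pt d) := by
      ext j
      simp [Finset.sum_apply, Pi.single_apply]
    rw [this]
    exact S.sum_mem fun i _ => S.zsmul_mem (h1 i) _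
  exact h2

lemma D_ne_zero {d : ℕ} (φ : ℕ → ℝ) (lam : ℝ) (x : Pt d) : DRf φ lam x ≠ 0 := by
  obtain ⟨a, ha⟩ := exists_path x
  intro h
  have := ENNReal.tsum_eq_zero.1 h ⟨a, ha⟩
  simp only [wR, ENNReal.ofReal_eq_zero, not_le.2 (Real.exp_pos _)] at this

/-! ### the limit along rays -/

/-- boxes -/
def boxF (d : ℕ) (R : ℕ) : Finset (Pt d) := Fintype.piFinset fun _ => Finset.Icc (-(R : ℤ)) R

lemma mem_boxF {d R : ℕ} (y : Pt d) : y ∈ boxF d R ↔ ∀ i, |y i| ≤ R := by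
  simp [boxF, Fintype.mem_piFinset, abs_le]

lemma card_boxF (d R : ℕ) : (boxF d R).card = (2 * R + 1) ^ d := by
  unfold boxF
  rw [Fintype.card_piFinset]
  simp only [Int.card_Icc, Finset.prod_const, Finset.card_univ, Fintype.card_fin]
  congr 1
  omega

lemma abs_floor_sub_le (a b : ℝ) (R : ℕ) (h : |a - b| + 1 ≤ R) : |⌊a⌋ - ⌊b⌋| ≤ (R : ℤ) := by
  have h1 := Int.floor_le a
  have h2 := Int.lt_floor_add_one a
  have h3 := Int.floor_le b
  have h4 := Int.lt_floor_add_one b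
  have h5 := le_abs_self (a - b)
  have h6 := neg_abs_le (a - b)
  have : ((|⌊a⌋ - ⌊b⌋| : ℤ) : ℝ) ≤ R := by
    push_cast
    rw [abs_le]
    constructor <;> linarith
  exact_mod_cast this

lemma lim_of_subadd {d : ℕ} (f : Pt d → ℝ) (hsub : ∀ x y, f (x + y) ≤ f x + f y)
    (K : ℝ) (hK : ∀ y, K ≤ f y) (x : Fin d → ℝ) :
    ∃ L : ℝ, Tendsto (fun M : ℝ => f (flr M x) / M) atTop (𝓝 L) := by
  obtain ⟨R, hR⟩ : ∃ R : ℕ, ∀ i, |x i| + 2 ≤ R := by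
    obtain ⟨R, hR⟩ := exists_nat_ge (∑ i, |x i| + 2)
    refine ⟨R, fun i => le_trans ?_ hR⟩
    have := Finset.single_le_sum (f := fun i => |x i|) (fun i _ => abs_nonneg _)
      (Finset.mem_univ i)
    linarith
  obtain ⟨B, hB⟩ : ∃ B, ∀ y ∈ boxF d R, f y ≤ B := by
    obtain ⟨B, hB⟩ := ((boxF d R).image f).bddAbove
    exact ⟨B, fun y hy => hB (by simpa using ⟨y, hy, rfl⟩)⟩
  have hclose : ∀ y z : Pt d, (∀ i, |y i - z i| ≤ (R : ℤ)) → f y ≤ f z + B := by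
    intro y z h
    have h1 := hsub z (y - z)
    rw [add_sub_cancel] at h1
    have h2 := hB (y - z) ((mem_boxF _).2 h)
    linarith
  let u : ℕ → ℝ := fun n => f (flr n x) + B
  have hu : Subadditive u := by
    intro m n
    have h1 : f (flr ((m + n : ℕ) : ℝ) x) ≤ f (flr m x + flr n x) + B := by
      apply hclose
      intro i
      have h2 := Int.le_floor_add ((m : ℝ) * x i) ((n : ℝ) * x i)
      have h3 := Int.le_floor_add_floor ((m : ℝ) * x i) ((n : ℝ) * x i)
      have h4 : (1 : ℤ) ≤ R := by
        have h5 := hR i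
        have h6 := abs_nonneg (x i)
        have : (1 : ℝ) ≤ R := by linarith
        exact_mod_cast this
      simp only [flr, Pi.add_apply]
      push_cast
      rw [add_mul, abs_le]
      constructor <;> omega
    have h2 := hsub (flr m x) (flr n x)
    simp only [u]
    linarith
  have hbdd : BddBelow (Set.range fun n : ℕ => u n / n) := by
    refine ⟨-|K + B|, ?_⟩
    rintro _ ⟨n, rfl⟩
    simp only
    rcases Nat.eq_zero_or_pos n with rfl | hn
    · simp
    · have hn' : (1 : ℝ) ≤ n := by exact_mod_cast hn
      rw [le_div_iff₀ (by linarith)]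
      have h1 : K + B ≤ u n := by simp only [u]; linarith [hK (flr n x)]
      have h2 := neg_abs_le (K + B)
      have h3 := abs_nonneg (K + B)
      nlinarith
  refine ⟨hu.lim, ?_⟩
  have h1 := (hu.tendsto_lim hbdd).comp (tendsto_nat_floor_atTop (α := ℝ))
  have h2 : Tendsto (fun M : ℝ => u ⌊M⌋₊ / M) atTop (𝓝 hu.lim) := by
    have h3 := h1.mul (tendsto_nat_floor_div_atTop (R := ℝ))
    rw [mul_one] at h3
    refine h3.congr' ?_
    filter_upwards [eventually_ge_atTop 1] with M hM
    have : 0 < ⌊M⌋₊ := Nat.floor_pos.2 hM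
    have h4 : (⌊M⌋₊ : ℝ) ≠ 0 := by positivity
    simp only [Function.comp]
    field_simp
  have h3 : Tendsto (fun M : ℝ => u ⌊M⌋₊ / M - 2 * B / M) atTop (𝓝 hu.lim) := by
    have := h2.sub (tendsto_const_nhds.div_atTop tendsto_id (a := 2 * B) (l := atTop))
    simpa using this
  have hfl : ∀ M : ℝ, 0 ≤ M → ∀ i, |M * x i - (⌊M⌋₊ : ℝ) * x i| + 1 ≤ R := by
    intro M hM i
    rw [← sub_mul, abs_mul]
    have h5 := Nat.floor_le hM
    have h6 := Nat.lt_floor_add_one M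
    have h7 : |M - ⌊M⌋₊| ≤ 1 := by rw [abs_le]; constructor <;> linarith
    have h8 := mul_le_mul_of_nonneg_right h7 (abs_nonneg (x i))
    linarith [hR i]
  refine tendsto_of_tendsto_of_tendsto_of_le_of_le' h3 h2 ?_ ?_
  · filter_upwards [eventually_ge_atTop 1] with M hM
    rw [← sub_div]
    apply div_le_div_of_nonneg_right _ (by linarith)
    have := hclose (flr (⌊M⌋₊ : ℝ) x) (flr M x) (fun i => by
      apply abs_floor_sub_le
      rw [abs_sub_comm]
      exact hfl M (by linarith) i)
    simp only [u]
    linarith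
  · filter_upwards [eventually_ge_atTop 1] with M hM
    apply div_le_div_of_nonneg_right _ (by linarith)
    exact hclose (flr M x) (flr (⌊M⌋₊ : ℝ) x) (fun i =>
      abs_floor_sub_le _ _ _ (hfl M (by linarith) i))

/-! ### the lower bound on `λ₀` -/

lemma abs_disp_le {d : ℕ} (a : List (Pt d)) (ha : IsPath a) (i : Fin d) :
    |disp a i| ≤ a.length := by
  induction a with
  | nil => simp [disp]
  | cons s b ih =>
    have h1 := ih (fun t ht => ha t (by simp [ht]))
    have h2 : ∑ i, |s i| = 1 := ha s (by simp)
    have h3 := Finset.single_le_sum (f := fun i => |s i|) (fun i _ => abs_nonneg _)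
      (Finset.mem_univ i)
    simp only [h2] at h3
    have h4 : disp (s :: b) i = s i + disp b i := by simp [disp]
    rw [h4]
    push_cast [List.length_cons]
    have := abs_add_le (s i) (disp b i)
    omega

lemma abs_pos_le {d : ℕ} (a : List (Pt d)) (ha : IsPath a) (k : ℕ) (i : Fin d) :
    |pos a k i| ≤ a.length := by
  have h1 := abs_disp_le (a.take k) (fun s hs => ha s (List.mem_of_mem_take hs)) i
  refine h1.trans ?_
  simp

/-- concatenations of `k` elements of `L`. -/
def catF {d : ℕ} (L : Finset (List (Pt d))) : ℕ → Finset (List (Pt d))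
  | 0 => {[]}
  | k + 1 => (L ×ˢ catF L k).image (fun p => p.1 ++ p.2)

lemma catF_spec {d n : ℕ} (L : Finset (List (Pt d)))
    (hL : ∀ a ∈ L, IsPath a ∧ a.length = n ∧ disp a = 0) (k : ℕ) :
    (catF L k).card = L.card ^ k ∧
    ∀ a ∈ catF L k, IsPath a ∧ a.length = n * k ∧ ∀ j ≤ a.length, pos a j ∈ boxF d n := by
  induction k with
  | zero =>
    refine ⟨by simp [catF], ?_⟩
    intro a ha
    simp only [catF, Finset.mem_singleton] at ha
    subst ha
    refine ⟨by simp [IsPath], by simp, ?_⟩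
    intro j _
    simp [pos, mem_boxF]
  | succ k ih =>
    constructor
    · rw [catF, Finset.card_image_of_injOn, Finset.card_product, ih.1, pow_succ, mul_comm]
      rintro ⟨a, b⟩ h ⟨a', b'⟩ h' he
      simp only [Finset.coe_product, Set.mem_prod, Finset.mem_coe] at h h'
      have := List.append_inj he (by rw [(hL a h.1).2.1, (hL a' h'.1).2.1])
      exact Prod.ext this.1 this.2
    · intro c hc
      simp only [catF, Finset.mem_image, Finset.mem_product, Prod.exists] at hc
      obtain ⟨a, b, ⟨ha, hb⟩, rfl⟩ := hc
      obtain ⟨ha1, ha2, ha3⟩ := hL a ha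
      obtain ⟨hb1, hb2, hb3⟩ := ih.2 b hb
      refine ⟨isPath_append.2 ⟨ha1, hb1⟩, by rw [List.length_append, ha2, hb2]; ring, ?_⟩
      intro j hj
      by_cases hja : j ≤ a.length
      · rw [pos_append_left a b hja, mem_boxF]
        intro i
        rw [← ha2]
        exact abs_pos_le a ha1 j i
      · have h2 := pos_append_right a b (j - a.length)
        rw [show a.length + (j - a.length) = j by omega, ha3, zero_add] at h2
        rw [h2]
        apply hb3
        rw [List.length_append] at hj
        omega

lemma ZR_ne_top (d : ℕ) (φ : ℕ → ℝ) (n : ℕ) : ZR d φ n ≠ ⊤ := by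
  unfold ZR
  rw [tsum_pathsN d n (fun a => ENNReal.ofReal (Real.exp (-PotR φ a)))]
  exact ENNReal.sum_ne_top.2 fun a _ => ENNReal.ofReal_ne_top

lemma ZR_ge {d n : ℕ} {φ : ℕ → ℝ} (hpos : ∀ n, 0 ≤ φ n) (hm : Monotone φ)
    (L : Finset (List (Pt d)))
    (hL : ∀ a ∈ L, IsPath a ∧ a.length = n ∧ disp a = 0) (k : ℕ) :
    (L.card : ℝ) ^ k * Real.exp (-((boxF d n).card * φ (n * k + 1))) ≤
      (ZR d φ (n * k)).toReal := by
  obtain ⟨hc, hs⟩ := catF_spec L hL k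
  rw [← ENNReal.ofReal_le_iff_le_toReal (ZR_ne_top d φ _)]
  unfold ZR
  rw [tsum_pathsN d _ (fun a => ENNReal.ofReal (Real.exp (-PotR φ a)))]
  have hsub : catF L k ⊆ pathF d (n * k) := fun a ha =>
    (mem_pathF _ _).2 ⟨(hs a ha).1, (hs a ha).2.1⟩
  refine le_trans ?_ (Finset.sum_le_sum_of_subset hsub)
  rw [← ENNReal.ofReal_sum_of_nonneg (fun _ _ => Real.exp_nonneg _)]
  apply ENNReal.ofReal_le_ofReal
  rw [← Nat.cast_pow, ← hc, ← nsmul_eq_mul]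
  apply Finset.card_nsmul_le_sum
  intro a ha
  apply Real.exp_le_exp.2
  apply neg_le_neg
  have hv : visited a ⊆ boxF d n := by
    intro z hz
    obtain ⟨j, hj, rfl⟩ := Finset.mem_image.1 hz
    exact (hs a ha).2.2 j (by simpa [Nat.lt_succ_iff] using hj)
  unfold PotR
  refine le_trans (Finset.sum_le_card_nsmul _ _ (φ (n * k + 1)) ?_) ?_
  · intro z _
    apply hm
    rw [← (hs a ha).2.1]
    exact locTime_le_length a z
  · rw [nsmul_eq_mul]
    exact mul_le_mul_of_nonneg_right (by exact_mod_cast Finset.card_le_card hv) (hpos _)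

lemma lam0_ge_of_loops {d n : ℕ} {φ : ℕ → ℝ} (hn : 0 < n) (hpos : ∀ n, 0 ≤ φ n)
    (hm : Monotone φ) (hA : ∀ l m : ℕ, φ (l + m) ≤ φ l + φ m)
    (hSL : Tendsto (fun n : ℕ => φ n / n) atTop (𝓝 0))
    (lam0 : ℝ)
    (hlam0 : Tendsto (fun n : ℕ => Real.log (ZR d φ n).toReal / n) atTop (𝓝 lam0))
    (L : Finset (List (Pt d))) (hLc : 0 < L.card)
    (hL : ∀ a ∈ L, IsPath a ∧ a.length = n ∧ disp a = 0) :
    Real.log L.card / n ≤ lam0 := by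
  have hnk : Tendsto (fun k : ℕ => n * k) atTop atTop := tendsto_id.const_mul_atTop' hn
  have h1 : Tendsto (fun N : ℕ => (boxF d n).card * (φ N / N + φ 1 / N)) atTop (𝓝 0) := by
    have h2 : Tendsto (fun N : ℕ => φ 1 / (N : ℝ)) atTop (𝓝 0) :=
      tendsto_const_nhds.div_atTop tendsto_natCast_atTop_atTop
    simpa using (hSL.add h2).const_mul ((boxF d n).card : ℝ)
  have h2 : Tendsto (fun N : ℕ => Real.log L.card / n -
      (boxF d n).card * (φ N / N + φ 1 / N)) atTop (𝓝 (Real.log L.card / n)) := by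
    simpa using tendsto_const_nhds.sub h1
  refine le_of_tendsto_of_tendsto (h2.comp hnk) (hlam0.comp hnk) ?_
  filter_upwards [eventually_gt_atTop 0] with k hk
  simp only [Function.comp]
  have hc : (0 : ℝ) < L.card := by exact_mod_cast hLc
  have hn' : (0 : ℝ) < n := by exact_mod_cast hn
  have hk' : (0 : ℝ) < k := by exact_mod_cast hk
  have h3 := Real.log_le_log (by positivity) (ZR_ge hpos hm L hL k)
  rw [Real.log_mul (by positivity) (by positivity), Real.log_exp, Real.log_pow] at h3
  have hN : (0 : ℝ) < ((n * k : ℕ) : ℝ) := by push_cast; positivity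
  rw [le_div_iff₀ hN]
  have h4 : (Real.log L.card / n - (boxF d n).card *
      (φ (n * k) / ((n * k : ℕ) : ℝ) + φ 1 / ((n * k : ℕ) : ℝ))) * ((n * k : ℕ) : ℝ) =
      k * Real.log L.card - (boxF d n).card * (φ (n * k) + φ 1) := by
    push_cast
    field_simp
  rw [h4]
  have h5 := mul_le_mul_of_nonneg_left (hA (n * k) 1) (Nat.cast_nonneg (α := ℝ) (boxF d n).card)
  linarith

lemma exists_loops {d : ℕ} (m : ℕ) :
    ∃ L : Finset (List (Pt d)), (∀ a ∈ L, IsPath a ∧ a.length = 2 * m ∧ disp a = 0) ∧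
      ((2 * d : ℝ) ^ m / (2 * m + 1) ^ d) ^ 2 ≤ L.card := by
  have hp := Finset.exists_le_card_fiber_of_nsmul_le_card_of_maps_to (s := pathF d m)
    (t := boxF d m) (f := disp) (b := (2 * d : ℝ) ^ m / (2 * m + 1) ^ d)
    (fun a ha => by
      rw [mem_pathF] at ha
      rw [mem_boxF, ← ha.2]
      exact abs_disp_le a ha.1)
    ⟨0, by simp [mem_boxF]⟩
    (by
      rw [card_boxF, card_pathF, nsmul_eq_mul]
      push_cast
      apply le_of_eq
      field_simp)
  obtain ⟨x, _, hx⟩ := hp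
  set A := (pathF d m).filter (fun a => disp a = x) with hAdef
  have hA : ∀ a ∈ A, (IsPath a ∧ a.length = m) ∧ disp a = x := by
    intro a ha
    rw [hAdef, Finset.mem_filter, mem_pathF] at ha
    exact ha
  refine ⟨(A ×ˢ A).image (fun p => p.1 ++ p.2.map (fun s => -s)), ?_, ?_⟩
  · intro c hc
    simp only [Finset.mem_image, Finset.mem_product, Prod.exists] at hc
    obtain ⟨a, b, ⟨ha, hb⟩, rfl⟩ := hc
    have ha := hA a ha
    have hb := hA b hb
    refine ⟨isPath_append.2 ⟨ha.1.1, ?_⟩, ?_, ?_⟩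
    · intro s hs
      obtain ⟨t, ht, rfl⟩ := List.mem_map.1 hs
      simpa [IsStep] using hb.1.1 t ht
    · rw [List.length_append, List.length_map, ha.1.2, hb.1.2]; ring
    · rw [disp_append, ha.2]
      have : disp (b.map (fun s => -s)) = -disp b := by
        simp only [disp]
        rw [List.sum_neg]
      rw [this, hb.2, add_neg_cancel]
  · rw [Finset.card_image_of_injOn, Finset.card_product]
    · push_cast
      rw [← sq]
      gcongr
    · rintro ⟨a, b⟩ h ⟨a', b'⟩ h' he
      simp only [Finset.coe_product, Set.mem_prod, Finset.mem_coe] at h h'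
      have := List.append_inj he (by rw [(hA a h.1).1.2, (hA a' h'.1).1.2])
      exact Prod.ext this.1 (List.map_injective_iff.2 neg_injective this.2)

lemma lam0_ge {d : ℕ} (hd : 1 ≤ d) {φ : ℕ → ℝ} (hpos : ∀ n, 0 ≤ φ n)
    (hm : Monotone φ) (hA : ∀ l m : ℕ, φ (l + m) ≤ φ l + φ m)
    (hSL : Tendsto (fun n : ℕ => φ n / n) atTop (𝓝 0))
    (lam0 : ℝ)
    (hlam0 : Tendsto (fun n : ℕ => Real.log (ZR d φ n).toReal / n) atTop (𝓝 lam0)) :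
    Real.log (2 * (d : ℝ)) ≤ lam0 := by
  have hd' : (0 : ℝ) < d := by exact_mod_cast hd
  have h1 : Tendsto (fun m : ℕ => Real.log (2 * (m : ℝ) + 1) / m) atTop (𝓝 0) := by
    have h2 : Tendsto (fun m : ℕ => 2 * (m : ℝ) + 1) atTop atTop :=
      tendsto_atTop_add_const_right _ _
        (tendsto_natCast_atTop_atTop.const_mul_atTop (by norm_num))
    have h3 := Real.isLittleO_log_id_atTop.tendsto_div_nhds_zero.comp h2
    have h4 : Tendsto (fun m : ℕ => 2 + 1 / (m : ℝ)) atTop (𝓝 (2 + 0)) :=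
      tendsto_const_nhds.add (tendsto_const_nhds.div_atTop tendsto_natCast_atTop_atTop)
    have h5 := h3.mul h4
    rw [zero_mul] at h5
    refine h5.congr' ?_
    filter_upwards [eventually_gt_atTop 0] with m hm
    have hm' : (0 : ℝ) < m := by exact_mod_cast hm
    simp only [Function.comp, id]
    field_simp
  have h2 : Tendsto (fun m : ℕ => Real.log (2 * (d : ℝ)) - d * (Real.log (2 * (m : ℝ) + 1) / m))
      atTop (𝓝 (Real.log (2 * (d : ℝ)))) := by
    simpa using tendsto_const_nhds.sub (h1.const_mul (d : ℝ))
  refine le_of_tendsto h2 ?_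
  filter_upwards [eventually_gt_atTop 0] with m hm0
  have hm' : (0 : ℝ) < m := by exact_mod_cast hm0
  obtain ⟨L, hL, hc⟩ := exists_loops (d := d) m
  have hpos' : (0 : ℝ) < ((2 * d : ℝ) ^ m / (2 * m + 1) ^ d) ^ 2 := by positivity
  have hLc : 0 < L.card := by
    have := hpos'.trans_le hc
    exact_mod_cast this
  have h3 := lam0_ge_of_loops (by omega) hpos hm hA hSL lam0 hlam0 L hLc hL
  refine le_trans ?_ h3
  have h4 := Real.log_le_log hpos' hc
  rw [Real.log_pow, Real.log_div (by positivity) (by positivity), Real.log_pow, Real.log_pow] at h4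
  rw [le_div_iff₀ (by push_cast; positivity)]
  refine le_trans (le_of_eq ?_) h4
  push_cast
  field_simp

end SIRW


/-- attractive case with (SL): `D_λ(x) ≤ H_λ(x) · Σ_{η : 0→0} e^{-λ|η|}`, the
loop sum being finite for `λ > log (2d)`; consequently the Lyapunov exponents defined via
`D_λ` and via `H_λ` both exist and coincide for `λ > λ₀`. -/
theorem stmt5 (d : ℕ) (hd : 1 ≤ d) (φ : ℕ → ℝ)
    (hpos : ∀ n, 0 ≤ φ n) (hN0 : φ 0 = 0) (hNmono : Monotone φ)
    (hA : ∀ l m : ℕ, φ (l + m) ≤ φ l + φ m)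
    (hSL : Filter.Tendsto (fun n : ℕ => φ n / n) Filter.atTop (nhds 0))
    (lam0 : ℝ)
    (hlam0 : Filter.Tendsto (fun n : ℕ => Real.log (ZR d φ n).toReal / n) Filter.atTop
      (nhds lam0)) :
    (∀ lam : ℝ, lam0 < lam → ∀ x : Pt d,
      DRf φ lam x ≤ HRf φ lam x *
        ∑' η : Dpaths (0 : Pt d),
          ENNReal.ofReal (Real.exp (-(lam * (η : List (Pt d)).length)))) ∧
    (∀ lam : ℝ, Real.log (2 * (d : ℝ)) < lam →
      (∑' η : Dpaths (0 : Pt d),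
        ENNReal.ofReal (Real.exp (-(lam * (η : List (Pt d)).length)))) ≠ ⊤) ∧
    (∀ lam : ℝ, lam0 < lam → ∀ x : Fin d → ℝ, ∃ ξx : ℝ,
      Filter.Tendsto (fun M : ℝ => -Real.log (HRf φ lam (flr M x)).toReal / M)
        Filter.atTop (nhds ξx) ∧
      Filter.Tendsto (fun M : ℝ => -Real.log (DRf φ lam (flr M x)).toReal / M)
        Filter.atTop (nhds ξx)) := by
  have hge := lam0_ge hd hpos hNmono hA hSL lam0 hlam0
  have hloop : ∀ lam : ℝ, Real.log (2 * (d : ℝ)) < lam →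
      (∑' η : Dpaths (0 : Pt d),
        ENNReal.ofReal (Real.exp (-(lam * (η : List (Pt d)).length)))) ≠ ⊤ := by
    intro lam hl
    refine ne_top_of_le_ne_top (sum_all_ne_top d hd lam hl) ?_
    exact ENNReal.tsum_mono_subtype
      (fun a : List (Pt d) => ENNReal.ofReal (Real.exp (-(lam * a.length)))) (fun _ h => h.1)
  refine ⟨fun lam _ x => D_le_H_mul hN0 hNmono lam x, hloop, ?_⟩
  intro lam hlam x
  have hl : Real.log (2 * (d : ℝ)) < lam := hge.trans_lt hlam
  have hCtop := hloop lam hl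
  have hDH := fun y : Pt d => D_le_H_mul (φ := φ) hN0 hNmono lam y
  set C := ∑' η : Dpaths (0 : Pt d),
        ENNReal.ofReal (Real.exp (-(lam * (η : List (Pt d)).length))) with hC
  have hC0 : C ≠ 0 := by
    intro h
    have := hDH 0
    rw [h, mul_zero] at this
    exact D_ne_zero φ lam (0 : Pt d) (le_antisymm this bot_le)
  have hall := sum_all_ne_top d hd lam hl
  have hDall := fun y : Pt d => D_le_all (φ := φ) hpos lam y
  set S := ∑' η : {a : List (Pt d) | IsPath a},
        ENNReal.ofReal (Real.exp (-(lam * (η : List (Pt d)).length))) with hS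
  have hDtop : ∀ y : Pt d, DRf φ lam y ≠ ⊤ := fun y => ne_top_of_le_ne_top hall (hDall y)
  have hHtop : ∀ y : Pt d, HRf φ lam y ≠ ⊤ := fun y =>
    ne_top_of_le_ne_top (hDtop y) (H_le_D φ lam y)
  have hH0 : ∀ y : Pt d, HRf φ lam y ≠ 0 := by
    intro y h
    have := hDH y
    rw [h, zero_mul] at this
    exact D_ne_zero φ lam y (le_antisymm this bot_le)
  have hDp : ∀ y : Pt d, 0 < (DRf φ lam y).toReal := fun y =>
    ENNReal.toReal_pos (D_ne_zero φ lam y) (hDtop y)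
  have hHp : ∀ y : Pt d, 0 < (HRf φ lam y).toReal := fun y =>
    ENNReal.toReal_pos (hH0 y) (hHtop y)
  have hCp : 0 < C.toReal := ENNReal.toReal_pos hC0 hCtop
  have l1 : ∀ y : Pt d, Real.log (DRf φ lam y).toReal ≤
      Real.log (HRf φ lam y).toReal + Real.log C.toReal := by
    intro y
    rw [← Real.log_mul (hHp y).ne' hCp.ne']
    apply Real.log_le_log (hDp y)
    rw [← ENNReal.toReal_mul]
    exact ENNReal.toReal_mono (ENNReal.mul_ne_top (hHtop y) hCtop) (hDH y)
  have l2 : ∀ y : Pt d, Real.log (HRf φ lam y).toReal ≤ Real.log (DRf φ lam y).toReal :=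
    fun y => Real.log_le_log (hHp y) (ENNReal.toReal_mono (hDtop y) (H_le_D φ lam y))
  have l3 : ∀ y z : Pt d, Real.log (HRf φ lam y).toReal + Real.log (DRf φ lam z).toReal ≤
      Real.log (DRf φ lam (y + z)).toReal := by
    intro y z
    rw [← Real.log_mul (hHp y).ne' (hDp z).ne']
    apply Real.log_le_log (mul_pos (hHp y) (hDp z))
    rw [← ENNReal.toReal_mul]
    exact ENNReal.toReal_mono (hDtop _) (H_mul_D_le hN0 hNmono hA lam y z)
  have l4 : ∀ y : Pt d, Real.log (DRf φ lam y).toReal ≤ Real.log S.toReal :=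
    fun y => Real.log_le_log (hDp y) (ENNReal.toReal_mono hall (hDall y))
  obtain ⟨ξ, hξ⟩ := lim_of_subadd
    (fun y : Pt d => -Real.log (DRf φ lam y).toReal + Real.log C.toReal)
    (fun y z => by linarith [l1 y, l3 y z]) (-Real.log S.toReal + Real.log C.toReal)
    (fun y => by linarith [l4 y]) x
  have hD : Tendsto (fun M : ℝ => -Real.log (DRf φ lam (flr M x)).toReal / M) atTop (𝓝 ξ) := by
    have h1 := hξ.sub
      (tendsto_const_nhds.div_atTop tendsto_id (a := Real.log C.toReal) (l := atTop))
    rw [sub_zero] at h1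
    refine h1.congr fun M => ?_
    simp only [id]
    ring
  refine ⟨ξ, ?_, hD⟩
  refine tendsto_of_tendsto_of_tendsto_of_le_of_le' hD hξ ?_ ?_
  · filter_upwards [eventually_gt_atTop 0] with M hM
    exact div_le_div_of_nonneg_right (by linarith [l2 (flr M x)]) hM.le
  · filter_upwards [eventually_gt_atTop 0] with M hM
    exact div_le_div_of_nonneg_right (by linarith [l1 (flr M x)]) hM.le
end
end

section
/- Let d ≥ 1 and let φ : ℕ → [0,∞] satisfy φ(0)=0, φ nondecreasing (condition (N)) and the repulsive condition (R): φ(l+m) ≥ φ(l)+φ(m). Then for every λ > λ₀ and all x, y ∈ ℤ^d the bubble-diagram inequality holds: H_λ(x)·H_λ(y) ≤ 2 e^{φ(1)} (Σ_{z∈ℤ^d} D_λ(z)²) · H_λ(x+y), and the bubble sum Σ_{z∈ℤ^d} D_λ(z)² is finite for every λ > λ₀. -/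
open scoped BigOperators ENNReal
open Filter Topology

noncomputable section

open SIRW

namespace SIRW

variable {d : ℕ}

/-- Occupation count of the path without its final point. -/
def frT (p : List (Pt d)) (u : Pt d) : ℕ :=
  ∑ j ∈ Finset.range p.length, if pos p j = u then 1 else 0

/-- Occupation count of the path without its initial point. -/
def tlT (q : List (Pt d)) (u : Pt d) : ℕ :=
  ∑ j ∈ Finset.range q.length, if pos q (j + 1) = u then 1 else 0

lemma locTime_eq (γ : List (Pt d)) (u : Pt d) :
    locTime γ u = ∑ j ∈ Finset.range (γ.length + 1), if pos γ j = u then 1 else 0 := by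
  unfold locTime
  rw [Finset.card_filter]

lemma pos_length_s6 (p : List (Pt d)) : pos p p.length = p.sum := by
  simp [pos]

lemma pos_zero (p : List (Pt d)) : pos p 0 = 0 := by
  simp [pos]

lemma pos_append_left_s6 (p q : List (Pt d)) {j : ℕ} (hj : j ≤ p.length) :
    pos (p ++ q) j = pos p j := by
  unfold pos
  rw [List.take_append_of_le_length hj]

lemma pos_append_right_s6 (p q : List (Pt d)) (j : ℕ) :
    pos (p ++ q) (p.length + j) = p.sum + pos q j := by
  unfold pos
  rw [List.take_length_add_append, List.sum_append]

lemma locTime_fr (p : List (Pt d)) (u : Pt d) :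
    locTime p u = frT p u + if p.sum = u then 1 else 0 := by
  rw [locTime_eq, Finset.sum_range_succ, pos_length_s6, frT]

lemma locTime_tl (p : List (Pt d)) (u : Pt d) :
    locTime p u = tlT p u + if 0 = u then 1 else 0 := by
  rw [locTime_eq, Finset.sum_range_succ', pos_zero, tlT]

lemma locTime_append_fr (p q : List (Pt d)) (u : Pt d) :
    locTime (p ++ q) u = frT p u + locTime q (u - p.sum) := by
  rw [locTime_eq, locTime_eq, List.length_append, add_assoc, Finset.sum_range_add, frT]
  congr 1
  · apply Finset.sum_congr rfl
    intro j hj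
    rw [pos_append_left_s6 _ _ (Finset.mem_range.1 hj).le]
  · apply Finset.sum_congr rfl
    intro j hj
    rw [pos_append_right_s6]
    simp only [eq_sub_iff_add_eq']

lemma locTime_append_tl (p q : List (Pt d)) (u : Pt d) :
    locTime (p ++ q) u = locTime p u + tlT q (u - p.sum) := by
  rw [locTime_append_fr, locTime_fr p, locTime_tl q]
  have : (0 = u - p.sum) ↔ (p.sum = u) := by
    rw [eq_comm, sub_eq_zero, eq_comm]
  simp only [this]
  ring

lemma locTime_pos_iff (b : List (Pt d)) (v : Pt d) :
    locTime b v = 0 ↔ ∀ m ≤ b.length, pos b m ≠ v := by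
  unfold locTime
  rw [Finset.card_eq_zero, Finset.filter_eq_empty_iff]
  simp [Nat.lt_succ_iff]

lemma PotE_eq (φ : ℕ → ℝ≥0∞) (hN0 : φ 0 = 0) (γ : List (Pt d)) :
    PotE φ γ = ∑' u, φ (locTime γ u) := by
  unfold PotE
  rw [tsum_eq_sum]
  intro u hu
  have : locTime γ u = 0 := by
    rw [locTime_pos_iff]
    intro m hm h
    apply hu
    unfold visited
    exact Finset.mem_image.2 ⟨m, Finset.mem_range.2 (Nat.lt_succ_of_le hm), h⟩
  rw [this, hN0]

/-- The decomposition of a pair of paths used in the bubble inequality. -/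
def Decomp (a b p A B q : List (Pt d)) : Prop :=
  a = p ++ A ∧ b = B ++ q ∧ A.sum + B.sum = 0 ∧
    (∀ u, frT p u ≠ 0 → locTime b (u - a.sum) = 0) ∧ tlT q 0 = 0

lemma exists_decomp (a b : List (Pt d)) : ∃ p A B q, Decomp a b p A B q := by
  classical
  have hex : ∃ k, k ≤ a.length ∧ ∃ m ≤ b.length, pos a k = a.sum + pos b m :=
    ⟨a.length, le_rfl, 0, Nat.zero_le _, by rw [pos_length_s6, pos_zero, add_zero]⟩
  obtain ⟨hk, m0, hm0, hz0⟩ := Nat.find_spec hex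
  have hmin := fun j => @Nat.find_min _ _ hex j
  set k := Nat.find hex with hkdef
  set m := Nat.findGreatest (fun m => pos a k = a.sum + pos b m) b.length with hm
  have hz : pos a k = a.sum + pos b m :=
    Nat.findGreatest_spec (P := fun m => pos a k = a.sum + pos b m) hm0 hz0
  have hmle : m ≤ b.length := Nat.findGreatest_le _
  have hmmax : ∀ j, m < j → j ≤ b.length → pos a k ≠ a.sum + pos b j := fun j h1 h2 =>
    Nat.findGreatest_is_greatest (P := fun m => pos a k = a.sum + pos b m) h1 h2
  refine ⟨a.take k, a.drop k, b.take m, b.drop m, (List.take_append_drop _ _).symm,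
    (List.take_append_drop _ _).symm, ?_, ?_, ?_⟩
  · have h1 := List.sum_take_add_sum_drop a k
    unfold pos at hz
    rw [hz, add_assoc] at h1
    rw [add_comm]
    exact add_eq_left.1 h1
  · intro u hu
    rw [frT] at hu
    obtain ⟨j, hj, hju⟩ := Finset.exists_ne_zero_of_sum_ne_zero hu
    have hjk : j < k := by
      have := Finset.mem_range.1 hj
      rw [List.length_take] at this
      omega
    have hpos : pos a j = u := by
      have h2 : pos (a.take k) j = u := by
        by_contra h
        simp [h] at hju
      rw [← h2]
      unfold pos
      rw [List.take_take, min_eq_left hjk.le]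
    rw [locTime_pos_iff]
    intro i hi h
    apply hmin j hjk
    exact ⟨hjk.le.trans hk, i, hi, by rw [h, hpos]; abel⟩
  · by_contra hu
    rw [tlT] at hu
    obtain ⟨j, hj, hju⟩ := Finset.exists_ne_zero_of_sum_ne_zero hu
    have h2 : pos (b.drop m) (j + 1) = 0 := by
      by_contra h
      simp [h] at hju
    have h3 := Finset.mem_range.1 hj
    rw [List.length_drop] at h3
    apply hmmax (m + (j + 1)) (by omega) (by omega)
    have h4 := pos_append_right_s6 (b.take m) (b.drop m) (j + 1)
    rw [List.take_append_drop, List.length_take, min_eq_left hmle, h2] at h4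
    rw [h4, hz, add_zero]
    rfl

section
variable {a b p A B q : List (Pt d)} 

lemma Decomp.psum (h : Decomp a b p A B q) : p.sum = a.sum + B.sum := by
  obtain ⟨rfl, rfl, h3, -, -⟩ := h
  rw [List.sum_append, add_assoc, h3, add_zero]

lemma Decomp.loc_eta (h : Decomp a b p A B q) (u : Pt d) :
    locTime (p ++ q) u = frT p u + tlT q (u - p.sum) + if u = p.sum then 1 else 0 := by
  rw [locTime_append_fr, locTime_tl, add_assoc]
  have : (0 = u - p.sum) ↔ (u = p.sum) := by
    rw [eq_comm, sub_eq_zero]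
  simp only [this]

lemma Decomp.loc_b (h : Decomp a b p A B q) (u : Pt d) :
    locTime b (u - a.sum) = locTime B (u - a.sum) + tlT q (u - p.sum) := by
  rw [h.psum]
  obtain ⟨-, rfl, -, -, -⟩ := h
  rw [locTime_append_tl, sub_sub]

lemma Decomp.fr_tl (h : Decomp a b p A B q) {u : Pt d} (hu : frT p u ≠ 0) :
    tlT q (u - p.sum) = 0 := by
  have h1 := h.2.2.2.1 u hu
  rw [h.loc_b] at h1
  omega

lemma Decomp.fr_z (h : Decomp a b p A B q) : frT p p.sum = 0 := by
  by_contra hu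
  have h1 := h.2.2.2.1 _ hu
  rw [h.loc_b, h.psum, add_sub_cancel_left, locTime_fr] at h1
  simp at h1

lemma Decomp.tl_z (h : Decomp a b p A B q) : tlT q (p.sum - p.sum) = 0 := by
  rw [sub_self]; exact h.2.2.2.2

lemma Decomp.loc_z (h : Decomp a b p A B q) : locTime (p ++ q) p.sum = 1 := by
  rw [h.loc_eta, h.fr_z, h.tl_z]; simp

lemma Decomp.pot (h : Decomp a b p A B q) (φ : ℕ → ℝ≥0∞) (hN0 : φ 0 = 0)
    (hR : ∀ l m : ℕ, φ l + φ m ≤ φ (l + m)) :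
    PotE φ A + PotE φ B + PotE φ (p ++ q) ≤ PotE φ a + PotE φ b + φ 1 := by
  have hshift : ∀ (c : Pt d) (γ : List (Pt d)), PotE φ γ = ∑' u, φ (locTime γ (u - c)) := by
    intro c γ
    rw [PotE_eq φ hN0, ← (Equiv.subRight c).tsum_eq]
    rfl
  have ha : ∑' u, φ (frT p u) + PotE φ A ≤ PotE φ a := by
    rw [hshift p.sum A, PotE_eq φ hN0, ← ENNReal.tsum_add]
    apply ENNReal.tsum_le_tsum
    intro u
    rw [h.1, locTime_append_fr]
    exact hR _ _
  have hb : PotE φ B + ∑' u, φ (tlT q (u - p.sum)) ≤ PotE φ b := by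
    rw [hshift a.sum B, hshift a.sum b, ← ENNReal.tsum_add]
    apply ENNReal.tsum_le_tsum
    intro u
    rw [h.loc_b]
    exact hR _ _
  have he : PotE φ (p ++ q) ≤ ∑' u, φ (frT p u) + ∑' u, φ (tlT q (u - p.sum)) + φ 1 := by
    have h1 : φ 1 = ∑' u : Pt d, if u = p.sum then φ 1 else 0 := by
      rw [tsum_ite_eq]
    rw [PotE_eq φ hN0]
    conv_rhs => rw [h1]
    rw [← ENNReal.tsum_add, ← ENNReal.tsum_add]
    apply ENNReal.tsum_le_tsum
    intro u
    rw [h.loc_eta]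
    by_cases hz : u = p.sum
    · subst hz
      rw [h.fr_z, h.tl_z]; simp [hN0]
    · by_cases hf : frT p u = 0
      · simp [hz, hf, hN0]
      · simp [hz, h.fr_tl hf, hN0]
  calc _ ≤ PotE φ A + PotE φ B +
        (∑' u, φ (frT p u) + ∑' u, φ (tlT q (u - p.sum)) + φ 1) := by gcongr
    _ = (∑' u, φ (frT p u) + PotE φ A) + (PotE φ B + ∑' u, φ (tlT q (u - p.sum))) + φ 1 := by ring
    _ ≤ _ := by gcongr

lemma IsPath.append {p q : List (Pt d)} (hp : IsPath p) (hq : IsPath q) : IsPath (p ++ q) := by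
  intro s hs
  rcases List.mem_append.1 hs with h | h
  · exact hp s h
  · exact hq s h

lemma Decomp.isPath (h : Decomp a b p A B q) (ha : IsPath a) (hb : IsPath b) :
    IsPath p ∧ IsPath A ∧ IsPath B ∧ IsPath q := by
  obtain ⟨rfl, rfl, -, -, -⟩ := h
  exact ⟨fun s hs => ha s (List.mem_append_left _ hs), fun s hs => ha s (List.mem_append_right _ hs),
    fun s hs => hb s (List.mem_append_left _ hs), fun s hs => hb s (List.mem_append_right _ hs)⟩

lemma Decomp.mem_H (h : Decomp a b p A B q) {x y : Pt d} (ha : a ∈ Hpaths x) (hb : b ∈ Hpaths y) :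
    p ++ q ∈ Hpaths (x + y) := by
  obtain ⟨ha1, ha2, ha3⟩ := ha
  obtain ⟨hb1, hb2, hb3⟩ := hb
  obtain ⟨hp, hA, hB, hq⟩ := h.isPath ha1 hb1
  unfold disp at ha2 hb2
  have hsum : p.sum + q.sum = x + y := by
    rw [h.psum, ← ha2, ← hb2, h.2.1, List.sum_append, add_assoc]
  refine ⟨hp.append hq, ?_, ?_⟩
  · rw [disp, List.sum_append, hsum]
  · by_cases hz : x + y = p.sum
    · rw [hz]; exact h.loc_z
    · have h1 : locTime b (x + y - a.sum) = 1 := by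
        rw [ha2, add_sub_cancel_left, hb3]
      have h2 : frT p (x + y) = 0 := by
        by_contra hf
        have := h.2.2.2.1 _ hf
        omega
      have h3 := h.loc_b (x + y)
      rw [h1] at h3
      have h4 : tlT q (x + y - p.sum) ≠ 0 := by
        have h5 := locTime_fr q (x + y - p.sum)
        rw [locTime_tl] at h5
        have h6 : q.sum = x + y - p.sum := by rw [← hsum]; abel
        have h7 : ¬ (0 = x + y - p.sum) := by
          intro h0; exact hz (sub_eq_zero.1 h0.symm)
        rw [if_pos h6, if_neg h7] at h5
        omega
      rw [h.loc_eta, h2, if_neg hz]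
      omega

lemma Decomp.inj {a' b' p' q' : List (Pt d)} (h : Decomp a b p A B q)
    (h' : Decomp a' b' p' A B q') (hsum : a.sum = a'.sum) (he : p ++ q = p' ++ q') :
    a = a' ∧ b = b' := by
  have hpp : p.sum = p'.sum := by rw [h.psum, h'.psum, hsum]
  have hlen : p.length = p'.length := by
    have h1 := h.loc_z
    unfold locTime at h1
    refine Finset.card_le_one.1 h1.le _ ?_ _ ?_
    · refine Finset.mem_filter.2 ⟨Finset.mem_range.2 ?_, ?_⟩
      · rw [List.length_append]; omega
      · rw [pos_append_left_s6 _ _ le_rfl, pos_length_s6]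
    · refine Finset.mem_filter.2 ⟨Finset.mem_range.2 ?_, ?_⟩
      · rw [he, List.length_append]; omega
      · rw [he, pos_append_left_s6 _ _ le_rfl, pos_length_s6, hpp]
  obtain ⟨rfl, rfl⟩ := List.append_inj he hlen
  exact ⟨h.1.trans h'.1.symm, h.2.1.trans h'.2.1.symm⟩

end

lemma expNegE_add (s t : ℝ≥0∞) : expNegE (s + t) = expNegE s * expNegE t := by
  unfold expNegE
  by_cases hs : s = ⊤
  · simp [hs]
  by_cases ht : t = ⊤
  · simp [ht]
  rw [if_neg hs, if_neg ht, if_neg (ENNReal.add_ne_top.2 ⟨hs, ht⟩), ENNReal.toReal_add hs ht,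
    neg_add, Real.exp_add, ENNReal.ofReal_mul (Real.exp_nonneg _)]

lemma expNegE_le_one (s : ℝ≥0∞) : expNegE s ≤ 1 := by
  unfold expNegE
  split_ifs
  · exact zero_le_one
  · rw [ENNReal.ofReal_le_one]
    exact Real.exp_le_one_iff.2 (by simp)

lemma expNegE_anti {s t : ℝ≥0∞} (h : s ≤ t) : expNegE t ≤ expNegE s := by
  obtain ⟨r, rfl⟩ := exists_add_of_le h
  rw [expNegE_add]
  exact mul_le_of_le_one_right' (expNegE_le_one r)

lemma expE_mul {s : ℝ≥0∞} (h : s ≠ ⊤) : expE s * expNegE s = 1 := by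
  unfold expE expNegE
  rw [if_neg h, if_neg h, ← ENNReal.ofReal_mul (Real.exp_nonneg _), ← Real.exp_add]
  simp

lemma le_PotE (φ : ℕ → ℝ≥0∞) (hN0 : φ 0 = 0) (hNmono : Monotone φ) (a : List (Pt d)) :
    φ 1 ≤ PotE φ a := by
  rw [PotE_eq φ hN0]
  refine le_trans ?_ (ENNReal.le_tsum (0 : Pt d))
  apply hNmono
  rw [locTime_tl]
  simp

lemma Decomp.weight {a b p A B q : List (Pt d)} (h : Decomp a b p A B q) (φ : ℕ → ℝ≥0∞)
    (hN0 : φ 0 = 0) (hNmono : Monotone φ)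
    (hR : ∀ l m : ℕ, φ l + φ m ≤ φ (l + m)) (lam : ℝ) :
    wE φ lam a * wE φ lam b ≤
      expE (φ 1) * (wE φ lam A * wE φ lam B * wE φ lam (p ++ q)) := by
  by_cases h1 : φ 1 = ⊤
  · have : PotE φ a = ⊤ := top_le_iff.1 (h1 ▸ le_PotE φ hN0 hNmono a)
    simp [wE, this, expNegE]
  have hpot := expNegE_anti (h.pot φ hN0 hR)
  simp only [expNegE_add] at hpot
  have hlen : ENNReal.ofReal (Real.exp (-(lam * a.length))) *
      ENNReal.ofReal (Real.exp (-(lam * b.length))) =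
      ENNReal.ofReal (Real.exp (-(lam * A.length))) *
      ENNReal.ofReal (Real.exp (-(lam * B.length))) *
      ENNReal.ofReal (Real.exp (-(lam * (p ++ q).length))) := by
    rw [h.1, h.2.1]
    simp only [← ENNReal.ofReal_mul (Real.exp_nonneg _),
      ← ENNReal.ofReal_mul (mul_nonneg (Real.exp_nonneg _) (Real.exp_nonneg _)), ← Real.exp_add]
    congr 2
    simp only [List.length_append]
    push_cast
    ring
  unfold wE
  calc _ = (expE (φ 1) * expNegE (φ 1)) * (expNegE (PotE φ a) * expNegE (PotE φ b)) *
        (ENNReal.ofReal (Real.exp (-(lam * a.length))) *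
      ENNReal.ofReal (Real.exp (-(lam * b.length)))) := by rw [expE_mul h1]; ring
    _ = expE (φ 1) * (expNegE (PotE φ a) * expNegE (PotE φ b) * expNegE (φ 1)) *
        (ENNReal.ofReal (Real.exp (-(lam * A.length))) *
      ENNReal.ofReal (Real.exp (-(lam * B.length))) *
      ENNReal.ofReal (Real.exp (-(lam * (p ++ q).length)))) := by rw [hlen]; ring
    _ ≤ expE (φ 1) * (expNegE (PotE φ A) * expNegE (PotE φ B) * expNegE (PotE φ (p ++ q))) *
        (ENNReal.ofReal (Real.exp (-(lam * A.length))) *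
      ENNReal.ofReal (Real.exp (-(lam * B.length))) *
      ENNReal.ofReal (Real.exp (-(lam * (p ++ q).length)))) := by gcongr
    _ = _ := by ring

/-- Target of the injection in the bubble inequality. -/
abbrev Tgt (v : Pt d) : Type := Σ w : Pt d, Dpaths w × Dpaths (-w) × Hpaths v

/-- Weight on the target of the injection. -/
def Gw (φ : ℕ → ℝ≥0∞) (lam : ℝ) (v : Pt d) (t : Tgt v) : ℝ≥0∞ :=
  expE (φ 1) * (wE φ lam t.2.1.1 * wE φ lam t.2.2.1.1 * wE φ lam t.2.2.2.1)

lemma exists_tgt (x y : Pt d) (ab : Hpaths x × Hpaths y) :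
    ∃ (t : Tgt (x + y)) (p q : List (Pt d)),
      Decomp ab.1.1 ab.2.1 p t.2.1.1 t.2.2.1.1 q ∧ t.2.2.2.1 = p ++ q := by
  obtain ⟨⟨a, ha⟩, ⟨b, hb⟩⟩ := ab
  obtain ⟨p, A, B, q, h⟩ := exists_decomp a b
  have hp := h.isPath ha.1 hb.1
  exact ⟨⟨A.sum, ⟨A, hp.2.1, rfl⟩,
    ⟨B, hp.2.2.1, (neg_eq_of_add_eq_zero_right h.2.2.1).symm⟩,
    ⟨p ++ q, h.mem_H ha hb⟩⟩, p, q, h, rfl⟩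

lemma exists_inj (φ : ℕ → ℝ≥0∞) (hN0 : φ 0 = 0) (hNmono : Monotone φ)
    (hR : ∀ l m : ℕ, φ l + φ m ≤ φ (l + m)) (lam : ℝ) (x y : Pt d) :
    ∃ F : Hpaths x × Hpaths y → Tgt (x + y), Function.Injective F ∧
      ∀ ab, wE φ lam ab.1.1 * wE φ lam ab.2.1 ≤ Gw φ lam (x + y) (F ab) := by
  choose F p q h1 h2 using exists_tgt x y
  refine ⟨F, ?_, ?_⟩
  · intro ab ab' hab
    have hd1 := h1 ab
    have e3 := h2 ab
    rw [hab] at hd1 e3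
    rw [h2 ab'] at e3
    have hs : ab.1.1.sum = ab'.1.1.sum := ab.1.2.2.1.trans ab'.1.2.2.1.symm
    obtain ⟨r1, r2⟩ := hd1.inj (h1 ab') hs e3.symm
    exact Prod.ext (Subtype.ext r1) (Subtype.ext r2)
  · intro ab
    have h3 := (h1 ab).weight φ hN0 hNmono hR lam
    rw [← h2 ab] at h3
    exact h3

lemma tsum_Gw (φ : ℕ → ℝ≥0∞) (lam : ℝ) (v : Pt d) :
    ∑' t, Gw φ lam v t =
      ∑' w : Pt d, expE (φ 1) * (DEf φ lam w * DEf φ lam (-w) * HEf φ lam v) := by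
  rw [ENNReal.tsum_sigma']
  refine tsum_congr fun w => ?_
  rw [ENNReal.tsum_prod']
  simp only [ENNReal.tsum_prod', Gw]
  simp only [ENNReal.tsum_mul_left, ENNReal.tsum_mul_right, mul_assoc]
  simp only [DEf, HEf]

lemma HH_eq (φ : ℕ → ℝ≥0∞) (lam : ℝ) (x y : Pt d) :
    HEf φ lam x * HEf φ lam y =
      ∑' ab : Hpaths x × Hpaths y, wE φ lam ab.1.1 * wE φ lam ab.2.1 := by
  rw [ENNReal.tsum_prod']
  simp only [ENNReal.tsum_mul_left, ENNReal.tsum_mul_right]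
  simp only [HEf]

lemma bubble (φ : ℕ → ℝ≥0∞) (hN0 : φ 0 = 0) (hNmono : Monotone φ)
    (hR : ∀ l m : ℕ, φ l + φ m ≤ φ (l + m)) (lam : ℝ) (x y : Pt d) :
    HEf φ lam x * HEf φ lam y ≤
      2 * expE (φ 1) * (∑' z : Pt d, (DEf φ lam z) ^ 2) * HEf φ lam (x + y) := by
  obtain ⟨F, hF, hFw⟩ := exists_inj φ hN0 hNmono hR lam x y
  calc HEf φ lam x * HEf φ lam y
      = ∑' ab : Hpaths x × Hpaths y, wE φ lam ab.1.1 * wE φ lam ab.2.1 := HH_eq φ lam x y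
    _ ≤ ∑' ab, Gw φ lam (x + y) (F ab) := ENNReal.tsum_le_tsum hFw
    _ ≤ ∑' t, Gw φ lam (x + y) t := ENNReal.tsum_comp_le_tsum_of_injective hF _
    _ = ∑' w : Pt d, expE (φ 1) * (DEf φ lam w * DEf φ lam (-w) * HEf φ lam (x + y)) :=
        tsum_Gw φ lam (x + y)
    _ ≤ ∑' w : Pt d, expE (φ 1) *
          ((DEf φ lam w ^ 2 + DEf φ lam (-w) ^ 2) * HEf φ lam (x + y)) := by
        refine ENNReal.tsum_le_tsum fun w => ?_
        gcongr
        rcases le_total (DEf φ lam w) (DEf φ lam (-w)) with hle | hle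
        · refine le_trans ?_ le_add_self
          rw [sq]; gcongr
        · refine le_trans ?_ le_self_add
          rw [sq]; gcongr
    _ = _ := by
        have hneg : ∑' w : Pt d, DEf φ lam (-w) ^ 2 = ∑' w : Pt d, DEf φ lam w ^ 2 :=
          (Equiv.neg (Pt d)).tsum_eq (fun w => DEf φ lam w ^ 2)
        rw [ENNReal.tsum_mul_left, ENNReal.tsum_mul_right, ENNReal.tsum_add, hneg]
        ring

lemma finite_steps (d : ℕ) : {s : Pt d | IsStep s}.Finite := by
  apply (Set.finite_Icc (-1 : Pt d) 1).subset
  intro s hs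
  have : ∀ i, |s i| ≤ 1 := fun i => by
    rw [← show (∑ i, |s i|) = 1 from hs]
    exact Finset.single_le_sum (f := fun i => |s i|) (fun j _ => abs_nonneg _) (Finset.mem_univ i)
  exact ⟨fun i => (abs_le.1 (this i)).1, fun i => (abs_le.1 (this i)).2⟩

lemma finite_paths (d n : ℕ) : (PathsN d n).Finite := by
  have : Finite {s : Pt d | IsStep s} := finite_steps d
  apply ((List.finite_length_eq {s : Pt d | IsStep s} n).image (List.map Subtype.val)).subset
  rintro γ ⟨h1, h2⟩
  refine ⟨γ.attach.map fun s => ⟨s.1, h1 s.1 s.2⟩, ?_, ?_⟩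
  · show (List.map _ _).length = n
    simpa using h2
  · simp [Function.comp_def]

lemma ZE_ne_top (φ : ℕ → ℝ≥0∞) (n : ℕ) : ZE d φ n ≠ ⊤ := by
  have : Fintype (PathsN d n) := (finite_paths d n).fintype
  unfold ZE
  rw [tsum_fintype]
  exact ENNReal.sum_ne_top.2 fun γ _ => ne_top_of_le_ne_top ENNReal.one_ne_top (expNegE_le_one _)

lemma tsum_D_le (φ : ℕ → ℝ≥0∞) (lam : ℝ) :
    ∑' z : Pt d, DEf φ lam z ≤
      ∑' n : ℕ, ZE d φ n * ENNReal.ofReal (Real.exp (-(lam * n))) := by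
  let F : (Σ z : Pt d, Dpaths z) → (Σ n : ℕ, PathsN d n) := fun t =>
    ⟨t.2.1.length, t.2.1, t.2.2.1, rfl⟩
  have hF : Function.Injective F := by
    rintro ⟨z, γ, h1, rfl⟩ ⟨z', γ', h1', rfl⟩ h
    have h2 := congrArg (fun t : (Σ n : ℕ, PathsN d n) => t.2.1) h
    simp only [F] at h2
    subst h2
    rfl
  calc _ = ∑' t : (Σ z : Pt d, Dpaths z), wE φ lam t.2.1 := by
        rw [ENNReal.tsum_sigma']; rfl
    _ = ∑' t, (fun s : (Σ n : ℕ, PathsN d n) => wE φ lam s.2.1) (F t) := rfl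
    _ ≤ ∑' s : (Σ n : ℕ, PathsN d n), wE φ lam s.2.1 :=
        ENNReal.tsum_comp_le_tsum_of_injective hF _
    _ = _ := by
        rw [ENNReal.tsum_sigma']
        refine tsum_congr fun n => ?_
        unfold ZE
        rw [← ENNReal.tsum_mul_right]
        refine tsum_congr fun γ => ?_
        rw [wE, γ.2.2]

lemma tsum_D_ne_top (φ : ℕ → ℝ≥0∞) (lam0 : ℝ)
    (hlam0 : Filter.Tendsto (fun n : ℕ => Real.log (ZE d φ n).toReal / n) Filter.atTop
      (nhds lam0)) (lam : ℝ) (hlam : lam0 < lam) : ∑' z : Pt d, DEf φ lam z ≠ ⊤ := by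
  obtain ⟨mu, hmu1, hmu2⟩ := exists_between hlam
  obtain ⟨N, hN⟩ := Filter.eventually_atTop.1 (hlam0.eventually (gt_mem_nhds hmu1))
  refine ne_top_of_le_ne_top ?_ (tsum_D_le φ lam)
  set T : ℕ → ℝ≥0∞ := fun n => ZE d φ n * ENNReal.ofReal (Real.exp (-(lam * n))) with hT
  have hTtop : ∀ n, T n ≠ ⊤ := fun n => ENNReal.mul_ne_top (ZE_ne_top φ n) ENNReal.ofReal_ne_top
  set r : ℝ≥0∞ := ENNReal.ofReal (Real.exp (mu - lam)) with hr
  have hr1 : r < 1 := by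
    rw [hr, ENNReal.ofReal_lt_one]
    rw [← Real.exp_zero]
    exact Real.exp_lt_exp.2 (by linarith)
  have hle : ∀ n, T n ≤ (if n ∈ Finset.range (N + 1) then T n else 0) + r ^ n := by
    intro n
    by_cases hn : n ∈ Finset.range (N + 1)
    · rw [if_pos hn]; exact le_self_add
    rw [if_neg hn, zero_add]
    have hn' : N + 1 ≤ n := by simpa using hn
    have h1 := hN n (by omega)
    have hnpos : (0 : ℝ) < n := by exact_mod_cast (by omega : 0 < n)
    rw [div_lt_iff₀ hnpos] at h1
    have h2 : (ZE d φ n).toReal ≤ Real.exp (mu * n) := by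
      rcases (ENNReal.toReal_nonneg (a := ZE d φ n)).eq_or_lt with h0 | h0
      · rw [← h0]; exact Real.exp_nonneg _
      · exact (Real.log_le_iff_le_exp h0).1 h1.le
    have h3 : ZE d φ n ≤ ENNReal.ofReal (Real.exp (mu * n)) := by
      rw [← ENNReal.ofReal_toReal (ZE_ne_top φ n)]
      exact ENNReal.ofReal_le_ofReal h2
    calc T n ≤ ENNReal.ofReal (Real.exp (mu * n)) * ENNReal.ofReal (Real.exp (-(lam * n))) := by
          rw [hT]; dsimp only; gcongr
      _ = r ^ n := by
          rw [hr, ← ENNReal.ofReal_mul (Real.exp_nonneg _), ← Real.exp_add,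
            ← ENNReal.ofReal_pow (Real.exp_nonneg _), ← Real.exp_nat_mul]
          congr 2
          ring
  refine ne_top_of_le_ne_top ?_ (ENNReal.tsum_le_tsum hle)
  rw [ENNReal.tsum_add, ENNReal.tsum_geometric]
  refine ENNReal.add_ne_top.2 ⟨?_, ?_⟩
  · rw [tsum_eq_sum (s := Finset.range (N + 1)) (fun n hn => if_neg hn)]
    refine ENNReal.sum_ne_top.2 fun n hn => ?_
    rw [if_pos hn]
    exact hTtop n
  · exact ENNReal.inv_ne_top.2 (tsub_pos_of_lt hr1).ne'

end SIRW

/-- repulsive case: the bubble-diagram inequality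
`H_λ(x) H_λ(y) ≤ 2 e^{φ(1)} (Σ_z D_λ(z)²) H_λ(x+y)`, the bubble sum being finite for every
`λ > λ₀`. -/
theorem stmt6 (d : ℕ) (hd : 1 ≤ d) (φ : ℕ → ℝ≥0∞)
    (hN0 : φ 0 = 0) (hNmono : Monotone φ)
    (hR : ∀ l m : ℕ, φ l + φ m ≤ φ (l + m))
    (lam0 : ℝ)
    (hlam0 : Filter.Tendsto (fun n : ℕ => Real.log (ZE d φ n).toReal / n) Filter.atTop
      (nhds lam0)) :
    ∀ lam : ℝ, lam0 < lam →
      (∑' z : Pt d, (DEf φ lam z) ^ 2) ≠ ⊤ ∧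
      (∀ x y : Pt d,
        HEf φ lam x * HEf φ lam y ≤
          2 * expE (φ 1) * (∑' z : Pt d, (DEf φ lam z) ^ 2) * HEf φ lam (x + y)) := by
  intro lam hlam
  refine ⟨?_, bubble φ hN0 hNmono hR lam⟩
  have hS := tsum_D_ne_top φ lam0 hlam0 lam hlam
  refine ne_top_of_le_ne_top (ENNReal.mul_ne_top hS hS) ?_
  rw [← ENNReal.tsum_mul_right]
  refine ENNReal.tsum_le_tsum fun z => ?_
  rw [sq]
  gcongr
  exact ENNReal.le_tsum z
end
end
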